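/- arXiv:2205.14431 — 2 statements merged into one kernel-verified Lean document; each statement's English description precedes it below -/
import Mathlib

section
/- Let N > 1 be an integer, α > 0 and let c > b > 0. The translating-profile problem has a unique solution Φ(·; c, b), it is defined on all of [0, ∞), it is C^∞ on [0, ∞), it satisfies Φ'(r) > 0 and Φ''(r) > 0 for all r > 0, and Φ'(r) → √(c²−b²)/b as r → ∞. -/
open Set Filter Topology

/-- Signed power: the usual real power for nonnegative arguments, extended oddly
to negative arguments (matching `x^{e}` for `1/e = p/q` with `p, q` odd). -/
noncomputable def oddPow (x e : ℝ) : ℝ := if 0 ≤ x then x ^ e else -((-x) ^ e)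

/-- `φ`, with first derivative `φ'` and second derivative `φ''`, solves the
translating-profile equation
`φ''/(1+φ'²) + ((N−1)/r)·φ' = (c/√(1+φ'²) − b)^{1/α}·√(1+φ'²)` for `r ∈ J`, `r ≠ 0`,
with the initial conditions `φ(0) = φ'(0) = 0`. -/
def IsProfileSolOn (N : ℕ) (α b c : ℝ) (J : Set ℝ) (φ φ' φ'' : ℝ → ℝ) : Prop :=
  φ 0 = 0 ∧ φ' 0 = 0 ∧
  (∀ r ∈ J, HasDerivWithinAt φ (φ' r) J r) ∧
  (∀ r ∈ J, HasDerivWithinAt φ' (φ'' r) J r) ∧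
  (∀ r ∈ J, r ≠ 0 →
    φ'' r / (1 + φ' r ^ 2) + (((N : ℝ) - 1) / r) * φ' r
      = oddPow (c / Real.sqrt (1 + φ' r ^ 2) - b) (1 / α) * Real.sqrt (1 + φ' r ^ 2))

/-- `φ` is the unique solution of the translating-profile problem, defined on its
maximal existence interval `[0, R)`: it is a solution there, and any solution on any
interval `[0, S)` satisfies `S ≤ R` and coincides with `φ` on `[0, S)`. -/
def IsMaxProfileSol (N : ℕ) (α b c R : ℝ) (φ φ' φ'' : ℝ → ℝ) : Prop :=
  0 < R ∧ IsProfileSolOn N α b c (Set.Ico 0 R) φ φ' φ'' ∧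
  ∀ S ψ ψ' ψ'', 0 < S → IsProfileSolOn N α b c (Set.Ico 0 S) ψ ψ' ψ'' →
    S ≤ R ∧ Set.EqOn ψ φ (Set.Ico 0 S)

/-- The averaged integral `∫₀¹ tⁿ F(t r) dt`. -/
noncomputable def hInt (n : ℕ) (F : ℝ → ℝ) (r : ℝ) : ℝ := ∫ t in (0:ℝ)..1, t ^ n * F (t * r)

lemma continuous_hInt (n : ℕ) {F : ℝ → ℝ} (hF : Continuous F) : Continuous (hInt n F) := by
  unfold hInt
  apply intervalIntegral.continuous_parametric_intervalIntegral_of_continuous'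
  fun_prop

lemma hInt_zero (n : ℕ) (F : ℝ → ℝ) : hInt n F 0 = F 0 / (n + 1) := by
  simp [hInt]
  field_simp

lemma pow_mul_hInt (n : ℕ) (F : ℝ → ℝ) (x : ℝ) :
    x ^ n * (x * hInt n F x) = ∫ u in (0:ℝ)..x, u ^ n * F u := by
  have h := intervalIntegral.mul_integral_comp_mul_right (a := 0) (b := 1)
    x (f := fun u => u ^ n * F u)
  simp only [zero_mul, one_mul] at h
  rw [← h, hInt]
  have : ∀ t : ℝ, (t * x) ^ n * F (t * x) = x ^ n * (t ^ n * F (t * x)) := by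
    intro t; ring
  simp only [this, intervalIntegral.integral_const_mul]
  ring

lemma hasDerivAt_mul_hInt (n : ℕ) {F : ℝ → ℝ} (hF : Continuous F) (r : ℝ) :
    HasDerivAt (fun x => x * hInt n F x) (F r - n * hInt n F r) r := by
  by_cases hr : r = 0
  · subst hr
    have h0 : F 0 - n * hInt n F 0 = hInt n F 0 := by
      rw [hInt_zero]; field_simp; ring
    rw [h0, hasDerivAt_iff_tendsto_slope]
    refine (((continuous_hInt n hF).tendsto 0).mono_left nhdsWithin_le_nhds).congr' ?_
    filter_upwards [self_mem_nhdsWithin] with x hx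
    have hx : x ≠ 0 := hx
    simp [slope_def_field]
    field_simp
  · have hI : HasDerivAt (fun x => ∫ u in (0:ℝ)..x, u ^ n * F u) (r ^ n * F r) r := by
      have hc : Continuous (fun u => u ^ n * F u) := by fun_prop
      exact intervalIntegral.integral_hasDerivAt_right (hc.intervalIntegrable _ _)
        hc.aestronglyMeasurable.stronglyMeasurableAtFilter hc.continuousAt
    have hd := hI.div (hasDerivAt_pow n r) (pow_ne_zero n hr)
    have he : (fun x => x * hInt n F x) =ᶠ[𝓝 r]
        (fun x => ∫ u in (0:ℝ)..x, u ^ n * F u) / (fun x => x ^ n) := by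
      filter_upwards [isOpen_ne.mem_nhds hr] with x hx
      have hx : x ≠ 0 := hx
      simp only [Pi.div_apply]
      rw [← pow_mul_hInt]
      field_simp
    refine (hd.congr_of_eventuallyEq he).congr_deriv ?_
    rw [← pow_mul_hInt]
    rcases n with _ | n
    · simp
    · simp
      field_simp
      ring

lemma hasDerivAt_hInt (n : ℕ) {F : ℝ → ℝ} (hF : ContDiff ℝ 1 F) (r : ℝ) :
    HasDerivAt (hInt n F) (hInt (n + 1) (deriv F) r) r := by
  have hc : Continuous F := hF.continuous
  have hd : Continuous (deriv F) := hF.continuous_deriv le_rfl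
  obtain ⟨C, hC⟩ := (isCompact_Icc (a := -(|r| + 1)) (b := |r| + 1)).exists_bound_of_continuousOn
    hd.continuousOn
  refine (intervalIntegral.hasDerivAt_integral_of_dominated_loc_of_deriv_le
    (F := fun x t => t ^ n * F (t * x)) (F' := fun x t => t ^ (n + 1) * deriv F (t * x))
    (bound := fun _ => C)
    (Metric.ball_mem_nhds r one_pos) ?_ ?_ ?_ ?_ ?_ ?_).2
  · refine Eventually.of_forall fun x => ?_
    have : Continuous (fun t : ℝ => t ^ n * F (t * x)) := by fun_prop
    exact this.aestronglyMeasurable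
  · apply Continuous.intervalIntegrable; fun_prop
  · have : Continuous (fun t : ℝ => t ^ (n + 1) * deriv F (t * r)) := by fun_prop
    exact this.aestronglyMeasurable
  · refine Eventually.of_forall fun t ht x hx => ?_
    rw [uIoc_of_le zero_le_one] at ht
    have hx1 : |x| ≤ |r| + 1 := by
      have := abs_sub_abs_le_abs_sub x r
      rw [Metric.mem_ball, Real.dist_eq] at hx
      linarith
    have htx : |t * x| ≤ |r| + 1 := by
      rw [abs_mul, abs_of_pos ht.1]
      have := mul_le_mul_of_nonneg_right ht.2 (abs_nonneg x)
      linarith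
    have h1 := hC (t * x) (abs_le.1 htx)
    rw [norm_mul, norm_pow, Real.norm_of_nonneg ht.1.le]
    have h2 : t ^ (n + 1) ≤ 1 := pow_le_one₀ ht.1.le ht.2
    have h3 := mul_le_mul_of_nonneg_right h2 (norm_nonneg (deriv F (t * x)))
    linarith
  · simp
  · refine Eventually.of_forall fun t ht x hx => ?_
    have h1 : HasDerivAt F (deriv F (t * x)) (t * x) :=
      (hF.differentiable one_ne_zero _).hasDerivAt
    have h2 := (h1.comp x ((hasDerivAt_id x).const_mul t)).const_mul (t ^ n)
    refine h2.congr_deriv ?_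
    ring

lemma contDiff_hInt (k : ℕ) : ∀ (n : ℕ) {F : ℝ → ℝ}, ContDiff ℝ k F → ContDiff ℝ k (hInt n F) := by
  induction k with
  | zero =>
    intro n F hF
    exact contDiff_zero.2 (continuous_hInt n (contDiff_zero.1 hF))
  | succ k ih =>
    intro n F hF
    have h1 : ContDiff ℝ 1 F := hF.of_le (by norm_cast; omega)
    have hd := hasDerivAt_hInt n h1
    push_cast at hF ⊢
    rw [contDiff_succ_iff_deriv] at hF ⊢
    refine ⟨fun x => (hd x).differentiableAt, by simp, ?_⟩
    have : deriv (hInt n F) = hInt (n + 1) (deriv F) := funext fun x => (hd x).deriv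
    rw [this]
    exact ih _ hF.2.2

lemma contDiff_of_fixed (n : ℕ) {a : ℝ} {g s : ℝ → ℝ} (hg : ContDiffOn ℝ (⊤ : ℕ∞) g (Ioo (-a) a))
    (hs : Continuous s) (hsa : ∀ r, s r ∈ Ioo (-a) a)
    (hfix : ∀ r, s r = r * hInt n (fun x => g (s x)) r) : ContDiff ℝ (⊤ : ℕ∞) s := by
  have hc : ∀ k : ℕ, ContDiff ℝ k s → ContDiff ℝ k (fun x => g (s x)) := fun k hk =>
    (hg.of_le (by exact_mod_cast le_top)).comp_contDiff hk hsa
  have hcs : Continuous (fun x => g (s x)) :=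
    (contDiff_zero (𝕜 := ℝ)).1 (by simpa using hc 0 (by simpa using hs))
  have hd : ∀ r, HasDerivAt s (g (s r) - n * hInt n (fun x => g (s x)) r) r := by
    intro r
    have := hasDerivAt_mul_hInt n hcs r
    exact this.congr_of_eventuallyEq (Eventually.of_forall hfix)
  rw [contDiff_infty]
  intro k
  induction k with
  | zero => simpa using hs
  | succ k ih =>
    push_cast
    rw [contDiff_succ_iff_deriv]
    refine ⟨fun x => (hd x).differentiableAt, by simp, ?_⟩
    rw [show deriv s = _ from funext fun x => (hd x).deriv]
    exact (hc k ih).sub (contDiff_const.mul (contDiff_hInt k n (hc k ih)))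

lemma exists_fixed (n : ℕ) {G : ℝ → ℝ} {L : NNReal} (hL : LipschitzWith L G) {M : ℝ}
    (hM : ∀ x, |G x| ≤ M) : ∃ s : ℝ → ℝ, Continuous s ∧ ∀ r, s r = r * hInt n (fun x => G (s x)) r := by
  have hGc := hL.continuous
  set K : ℝ := 2 * L + 1 with hK
  have hK0 : 0 < K := by positivity
  have hM0 : 0 ≤ M := (abs_nonneg _).trans (hM 0)
  -- key integral
  have hbd_int : ∀ r : ℝ, Real.exp (-(K * |r|)) * (|r| * ∫ t in (0:ℝ)..1, Real.exp (K * |t * r|)) ≤ 1 / K := by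
    intro r
    have e1 : ∫ t in (0:ℝ)..1, Real.exp (K * |t * r|) = ∫ t in (0:ℝ)..1, Real.exp (t * (K * |r|)) := by
      apply intervalIntegral.integral_congr
      intro t ht
      rw [uIcc_of_le zero_le_one] at ht
      simp only [abs_mul, abs_of_nonneg ht.1]
      congr 1; ring
    have e2 := intervalIntegral.mul_integral_comp_mul_right (a := 0) (b := 1)
      (K * |r|) (f := fun u => Real.exp u)
    simp only [zero_mul, one_mul, integral_exp, Real.exp_zero] at e2
    rw [e1]
    have e3 : |r| * ∫ t in (0:ℝ)..1, Real.exp (t * (K * |r|)) = (Real.exp (K * |r|) - 1) / K := by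
      rw [← e2, mul_assoc, mul_div_cancel_left₀ _ hK0.ne']
    rw [e3, Real.exp_neg, le_div_iff₀ hK0]
    have := Real.exp_pos (K * |r|)
    field_simp
    linarith
  let op : (ℝ → ℝ) → ℝ → ℝ := fun v r =>
    Real.exp (-(K * |r|)) * (r * hInt n (fun x => G (Real.exp (K * |x|) * v x)) r)
  have hopc : ∀ v, Continuous v → Continuous (op v) := by
    intro v hv
    have h1 := continuous_hInt n (F := fun x => G (Real.exp (K * |x|) * v x)) (by fun_prop)
    simp only [op]
    fun_prop
  have hpw : ∀ t ∈ Icc (0:ℝ) 1, t ^ n ≤ 1 := fun t ht => pow_le_one₀ ht.1 ht.2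
  have hopb : ∀ v, Continuous v → ∀ r, ‖op v r‖ ≤ M * (1 / K) := by
    intro v hv r
    have h1 : |hInt n (fun x => G (Real.exp (K * |x|) * v x)) r| ≤
        ∫ t in (0:ℝ)..1, M * Real.exp (K * |t * r|) := by
      rw [hInt, ← Real.norm_eq_abs]
      apply intervalIntegral.norm_integral_le_of_norm_le zero_le_one
      · refine Eventually.of_forall fun t ht => ?_
        have h0 : t ∈ Icc (0:ℝ) 1 := ⟨ht.1.le, ht.2⟩
        rw [norm_mul, norm_pow, Real.norm_of_nonneg ht.1.le, Real.norm_eq_abs]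
        have := hM (Real.exp (K * |t * r|) * v (t * r))
        have h3 : 1 ≤ Real.exp (K * |t * r|) := Real.one_le_exp (by positivity)
        calc _ ≤ 1 * M := mul_le_mul (hpw t h0) this (abs_nonneg _) zero_le_one
          _ ≤ _ := by nlinarith
      · apply Continuous.intervalIntegrable; fun_prop
    rw [intervalIntegral.integral_const_mul] at h1
    simp only [op, norm_mul, Real.norm_eq_abs, Real.abs_exp]
    calc _ ≤ Real.exp (-(K * |r|)) * (|r| * (M * ∫ t in (0:ℝ)..1, Real.exp (K * |t * r|))) := by gcongr
      _ = M * (Real.exp (-(K * |r|)) * (|r| * ∫ t in (0:ℝ)..1, Real.exp (K * |t * r|))) := by ring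
      _ ≤ _ := mul_le_mul_of_nonneg_left (hbd_int r) hM0
  let T : BoundedContinuousFunction ℝ ℝ → BoundedContinuousFunction ℝ ℝ := fun v =>
    BoundedContinuousFunction.ofNormedAddCommGroup (op v) (hopc v v.continuous) _ (hopb v v.continuous)
  have hT : ContractingWith (1/2) T := by
    refine ⟨by norm_num, LipschitzWith.of_dist_le_mul fun v w => ?_⟩
    rw [BoundedContinuousFunction.dist_le (by positivity)]
    intro r
    change dist (op v r) (op w r) ≤ _
    set d := dist v w
    have hd0 : 0 ≤ d := dist_nonneg
    have hv := v.continuous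
    have hw := w.continuous
    have e : op v r - op w r = Real.exp (-(K * |r|)) * (r * ∫ t in (0:ℝ)..1,
        t ^ n * (G (Real.exp (K * |t * r|) * v (t * r)) - G (Real.exp (K * |t * r|) * w (t * r)))) := by
      simp only [op, hInt, mul_sub]
      rw [intervalIntegral.integral_sub]
      · ring
      · apply Continuous.intervalIntegrable; fun_prop
      · apply Continuous.intervalIntegrable; fun_prop
    have h1 : ‖∫ t in (0:ℝ)..1,
        t ^ n * (G (Real.exp (K * |t * r|) * v (t * r)) - G (Real.exp (K * |t * r|) * w (t * r)))‖ ≤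
        ∫ t in (0:ℝ)..1, (L * d) * Real.exp (K * |t * r|) := by
      apply intervalIntegral.norm_integral_le_of_norm_le zero_le_one
      · refine Eventually.of_forall fun t ht => ?_
        have h0 : t ∈ Icc (0:ℝ) 1 := ⟨ht.1.le, ht.2⟩
        rw [norm_mul, norm_pow, Real.norm_of_nonneg ht.1.le]
        have h2 := hL.norm_sub_le (Real.exp (K * |t * r|) * v (t * r)) (Real.exp (K * |t * r|) * w (t * r))
        rw [← mul_sub, norm_mul, Real.norm_eq_abs (Real.exp _), Real.abs_exp, ← dist_eq_norm (v _)] at h2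
        have h3 := BoundedContinuousFunction.dist_coe_le_dist (f := v) (g := w) (t * r)
        have h4 : L * (Real.exp (K * |t * r|) * dist (v (t * r)) (w (t * r))) ≤ L * (Real.exp (K * |t * r|) * d) := by
          gcongr
        calc _ ≤ 1 * (L * (Real.exp (K * |t * r|) * d)) :=
              mul_le_mul (hpw t h0) (h2.trans h4) (norm_nonneg _) zero_le_one
          _ = _ := by ring
      · apply Continuous.intervalIntegrable; fun_prop
    rw [intervalIntegral.integral_const_mul] at h1
    rw [Real.dist_eq, e, abs_mul, abs_mul, Real.abs_exp]
    calc _ ≤ Real.exp (-(K * |r|)) * (|r| * ((L * d) * ∫ t in (0:ℝ)..1, Real.exp (K * |t * r|))) := by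
          gcongr; exact h1
      _ = (L * d) * (Real.exp (-(K * |r|)) * (|r| * ∫ t in (0:ℝ)..1, Real.exp (K * |t * r|))) := by ring
      _ ≤ (L * d) * (1 / K) := mul_le_mul_of_nonneg_left (hbd_int r) (by positivity)
      _ ≤ _ := by
        push_cast
        rw [mul_one_div, div_le_iff₀ hK0, hK]
        nlinarith
  set v := hT.fixedPoint T
  have hv : T v = v := hT.fixedPoint_isFixedPt
  have hvc := v.continuous
  refine ⟨fun r => Real.exp (K * |r|) * v r, by fun_prop, fun r => ?_⟩
  have h1 : op v r = v r := DFunLike.congr_fun hv r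
  change Real.exp (K * |r|) * v r = _
  rw [← h1]
  simp only [op, ← mul_assoc, ← Real.exp_add]
  simp

lemma uniq_aux {n : ℕ} (hn : 1 ≤ n) {g : ℝ → ℝ} (hg : AntitoneOn g (Ici 0)) {S : ℝ} {s₁ s₂ : ℝ → ℝ}
    (hc₁ : ContinuousOn s₁ (Ico 0 S)) (hc₂ : ContinuousOn s₂ (Ico 0 S))
    (h₁ : ∀ r ∈ Ioo 0 S, 0 ≤ s₁ r) (h₂ : ∀ r ∈ Ioo 0 S, 0 ≤ s₂ r)
    (hd₁ : ∀ r ∈ Ioo 0 S, HasDerivAt (fun x => x ^ n * s₁ x) (r ^ n * g (s₁ r)) r)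
    (hd₂ : ∀ r ∈ Ioo 0 S, HasDerivAt (fun x => x ^ n * s₂ x) (r ^ n * g (s₂ r)) r) :
    ∀ r ∈ Ioo 0 S, s₁ r = s₂ r := by
  have hd : ∀ r ∈ Ioo 0 S, HasDerivAt (fun x => (x ^ n * s₁ x - x ^ n * s₂ x) ^ 2)
      (2 * (r ^ n * s₁ r - r ^ n * s₂ r) * (r ^ n * g (s₁ r) - r ^ n * g (s₂ r))) r := by
    intro r hr
    refine (((hd₁ r hr).sub (hd₂ r hr)).pow 2).congr_deriv ?_
    simp
  have hanti : AntitoneOn (fun x => (x ^ n * s₁ x - x ^ n * s₂ x) ^ 2) (Ico 0 S) := by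
    refine antitoneOn_of_deriv_nonpos (convex_Ico 0 S) (by fun_prop) ?_ ?_
    · rw [interior_Ico]
      exact fun r hr => (hd r hr).differentiableAt.differentiableWithinAt
    · rw [interior_Ico]
      intro r hr
      rw [(hd r hr).deriv]
      have e : 2 * (r ^ n * s₁ r - r ^ n * s₂ r) * (r ^ n * g (s₁ r) - r ^ n * g (s₂ r)) =
        2 * (r ^ n) ^ 2 * ((s₁ r - s₂ r) * (g (s₁ r) - g (s₂ r))) := by ring
      rw [e]
      refine mul_nonpos_of_nonneg_of_nonpos (by positivity) ?_
      rcases le_total (s₁ r) (s₂ r) with h | h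
      · have := hg (h₁ r hr) (h₂ r hr) h
        exact mul_nonpos_of_nonpos_of_nonneg (by linarith) (by linarith)
      · have := hg (h₂ r hr) (h₁ r hr) h
        exact mul_nonpos_of_nonneg_of_nonpos (by linarith) (by linarith)
  intro r hr
  have h := hanti ⟨le_rfl, hr.1.trans hr.2⟩ ⟨hr.1.le, hr.2⟩ hr.1.le
  have hn0 : n ≠ 0 := by omega
  simp only [zero_pow hn0, zero_mul, sub_self] at h
  have h0 : r ^ n * s₁ r - r ^ n * s₂ r = 0 := by
    have := le_antisymm (h.trans_eq (by norm_num)) (sq_nonneg _)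
    exact pow_eq_zero_iff (two_ne_zero) |>.1 this
  rw [← mul_sub] at h0
  rcases mul_eq_zero.1 h0 with h0 | h0
  · exact absurd h0 (pow_ne_zero _ hr.1.ne')
  · linarith

lemma exists_upto {n : ℕ} (hn : 1 ≤ n) {g : ℝ → ℝ} {a : ℝ} (ha : 0 < a) (hgc : Continuous g)
    (hg : AntitoneOn g (Ici 0)) (hpos : ∀ x, 0 ≤ x → x < a → 0 < g x) (hga : g a = 0)
    (hsm : ContDiffOn ℝ (⊤ : ℕ∞) g (Ioo (-a) a)) {R : ℝ} (hR : 0 < R) :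
    ∃ s : ℝ → ℝ, Continuous s ∧ (∀ r ∈ Icc 0 R, 0 ≤ s r ∧ s r < a) ∧
      ∀ r ∈ Icc 0 R, s r = r * hInt n (fun x => g (s x)) r := by
  have hn' : (0:ℝ) < n := by exact_mod_cast hn
  obtain ⟨σ, hσ1, hσ0, hσa⟩ : ∃ σ, g σ < n * σ / R ∧ 0 < σ ∧ σ < a := by
    have hc : Continuous (fun x => g x - n * x / R) := by fun_prop
    have h1 : ∀ᶠ x in 𝓝 a, g x - n * x / R < 0 := by
      refine hc.continuousAt.eventually_lt continuousAt_const ?_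
      rw [hga]
      have : 0 < n * a / R := by positivity
      linarith
    have h2 : ∀ᶠ x in 𝓝[<] a, x ∈ Ioo 0 a := Ioo_mem_nhdsLT ha
    obtain ⟨σ, h3, h4⟩ := ((h1.filter_mono nhdsWithin_le_nhds).and h2).exists
    exact ⟨σ, by linarith, h4.1, h4.2⟩
  obtain ⟨L, hL⟩ : ∃ L, LipschitzOnWith L g (Icc 0 σ) := by
    refine ContDiffOn.exists_lipschitzOnWith (n := 1) ?_ one_ne_zero (convex_Icc _ _) isCompact_Icc
    exact (hsm.of_le (by exact_mod_cast le_top)).mono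
      (fun x hx => ⟨by linarith [hx.1], by linarith [hx.2]⟩)
  set cl : ℝ → ℝ := fun x => max 0 (min x σ) with hcl
  have hclm : ∀ x, cl x ∈ Icc 0 σ := fun x =>
    ⟨le_max_left _ _, max_le hσ0.le (min_le_right _ _)⟩
  have hclL : LipschitzWith 1 cl := (LipschitzWith.id.min_const σ).const_max 0
  have hGL : LipschitzWith L (fun x => g (cl x)) := by
    have := hL.comp (hclL.lipschitzOnWith (s := univ)) (fun x _ => hclm x)
    rw [lipschitzOnWith_univ, mul_one] at this
    exact this
  have hGpos : ∀ x, 0 < g (cl x) := fun x => hpos _ (hclm x).1 ((hclm x).2.trans_lt hσa)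
  obtain ⟨s, hsc, hs⟩ := exists_fixed n hGL (M := g 0) (fun x => by
    rw [abs_of_pos (hGpos x)]
    exact hg (mem_Ici.2 le_rfl) (hclm x).1 (hclm x).1)
  have hGc : Continuous (fun x => g (cl (s x))) := hGL.continuous.comp hsc
  have hs0 : ∀ r, 0 ≤ r → 0 ≤ s r := by
    intro r hr
    rw [hs r]
    refine mul_nonneg hr (intervalIntegral.integral_nonneg zero_le_one fun t ht => ?_)
    exact mul_nonneg (pow_nonneg ht.1 _) (hGpos _).le
  have hd : ∀ r, HasDerivAt s (g (cl (s r)) - n * hInt n (fun x => g (cl (s x))) r) r := fun r =>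
    (hasDerivAt_mul_hInt n hGc r).congr_of_eventuallyEq (Eventually.of_forall hs)
  have hsz : s 0 = 0 := by rw [hs 0, zero_mul]
  have hle : ∀ r ∈ Icc 0 R, s r ≤ σ := by
    refine fun r hr => image_le_of_deriv_right_lt_deriv_boundary (a := 0) (b := R)
      (B := fun _ => σ) (B' := fun _ => 0) hsc.continuousOn
      (fun x _ => (hd x).hasDerivWithinAt) (by rw [hsz]; exact hσ0.le)
      (fun x => hasDerivAt_const x σ) ?_ hr
    intro x hx hxσ
    have hx0 : 0 < x := by
      rcases hx.1.eq_or_lt with h | h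
      · rw [← h, hsz] at hxσ; exact absurd hxσ hσ0.ne
      · exact h
    have h1 : x * hInt n (fun x => g (cl (s x))) x = σ := by rw [← hs, hxσ]
    have h2 : cl (s x) = σ := by simp [hcl, hxσ, hσ0.le]
    rw [h2]
    have h3 : hInt n (fun x => g (cl (s x))) x = σ / x := by rw [← h1]; field_simp
    rw [h3]
    have h4 : n * σ / R ≤ n * σ / x := by gcongr; exact hx.2.le
    rw [← mul_div_assoc]
    linarith
  refine ⟨s, hsc, fun r hr => ⟨hs0 r hr.1, (hle r hr).trans_lt hσa⟩, fun r hr => ?_⟩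
  conv_lhs => rw [hs r]
  congr 1
  apply intervalIntegral.integral_congr
  intro t ht
  rw [uIcc_of_le zero_le_one] at ht
  have h0 : 0 ≤ t * r := mul_nonneg ht.1 hr.1
  have h1 : t * r ≤ R := (mul_le_of_le_one_left hr.1 ht.2).trans hr.2
  have h2 : cl (s (t * r)) = s (t * r) := by
    simp [hcl, hle _ ⟨h0, h1⟩, hs0 _ h0]
  simp only [h2]

lemma hasDerivAt_pow_mul_of_fixed {n : ℕ} {g s : ℝ → ℝ} {R : ℝ} (hgs : Continuous (fun x => g (s x)))
    (hs : ∀ r ∈ Icc 0 R, s r = r * hInt n (fun x => g (s x)) r) :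
    ∀ r ∈ Ioo 0 R, HasDerivAt (fun x => x ^ n * s x) (r ^ n * g (s r)) r := by
  intro r hr
  have hc : Continuous (fun u => u ^ n * g (s u)) := (continuous_pow n).mul hgs
  have hI : HasDerivAt (fun x => ∫ u in (0:ℝ)..x, u ^ n * g (s u)) (r ^ n * g (s r)) r :=
    intervalIntegral.integral_hasDerivAt_right (hc.intervalIntegrable _ _)
        hc.aestronglyMeasurable.stronglyMeasurableAtFilter hc.continuousAt
  refine hI.congr_of_eventuallyEq ?_
  filter_upwards [Icc_mem_nhds hr.1 hr.2] with x hx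
  rw [hs x hx, ← pow_mul_hInt]

lemma exists_global {n : ℕ} (hn : 1 ≤ n) {g : ℝ → ℝ} {a : ℝ} (ha : 0 < a) (hgc : Continuous g)
    (hg : AntitoneOn g (Ici 0)) (hpos : ∀ x, 0 ≤ x → x < a → 0 < g x) (hga : g a = 0)
    (heven : ∀ x, g (-x) = g x)
    (hsm : ContDiffOn ℝ (⊤ : ℕ∞) g (Ioo (-a) a)) :
    ∃ s : ℝ → ℝ, Continuous s ∧ (∀ r, s r ∈ Ioo (-a) a) ∧ (∀ r, 0 ≤ r → 0 ≤ s r) ∧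
      ∀ r, s r = r * hInt n (fun x => g (s x)) r := by
  have hex : ∀ k : ℕ, _ := fun k =>
    exists_upto hn ha hgc hg hpos hga hsm (R := (k:ℝ) + 1) (by positivity)
  choose f hfc hfb hff using hex
  have hfg : ∀ k, Continuous (fun x => g (f k x)) := fun k => hgc.comp (hfc k)
  have hf0 : ∀ k, f k 0 = 0 := fun k => by
    rw [hff k 0 ⟨le_rfl, by positivity⟩, zero_mul]
  have key : ∀ j k : ℕ, j ≤ k → ∀ r, 0 ≤ r → r < (j:ℝ) + 1 → f j r = f k r := by
    intro j k hjk r hr0 hr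
    have hjk' : (j:ℝ) ≤ k := by exact_mod_cast hjk
    rcases hr0.eq_or_lt with h | h
    · rw [← h, hf0, hf0]
    · refine uniq_aux hn hg (S := (j:ℝ) + 1) (hfc j).continuousOn (hfc k).continuousOn ?_ ?_
        (hasDerivAt_pow_mul_of_fixed (hfg j) (hff j)) ?_ r ⟨h, hr⟩
      · exact fun x hx => (hfb j x ⟨hx.1.le, hx.2.le⟩).1
      · exact fun x hx => (hfb k x ⟨hx.1.le, by linarith [hx.2]⟩).1
      · exact fun x hx => hasDerivAt_pow_mul_of_fixed (hfg k) (hff k) x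
          ⟨hx.1, by linarith [hx.2]⟩
  -- the value of the odd extension
  set s : ℝ → ℝ := fun r => r * hInt n (fun x => g (f ⌊|r|⌋₊ x)) |r| with hsdef
  have hloc : ∀ (k : ℕ) (r : ℝ), |r| < k + 1 → s r = r * hInt n (fun x => g (f k x)) |r| := by
    intro k r hr
    have hj : ⌊|r|⌋₊ ≤ k := by
      have : ⌊|r|⌋₊ < k + 1 := (Nat.floor_lt (abs_nonneg r)).2 (by exact_mod_cast hr)
      omega
    simp only [hsdef, hInt]
    congr 1
    apply intervalIntegral.integral_congr
    intro t ht
    rw [uIcc_of_le zero_le_one] at ht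
    have h1 : t * |r| ≤ |r| := mul_le_of_le_one_left (abs_nonneg r) ht.2
    simp only
    rw [key _ k hj (t * |r|) (mul_nonneg ht.1 (abs_nonneg r))
      (h1.trans_lt (Nat.lt_floor_add_one _))]
  have habs : ∀ (k : ℕ) (r : ℝ), |r| < k + 1 → |s r| = f k |r| := by
    intro k r hr
    have hm : |r| ∈ Icc (0:ℝ) (k + 1) := ⟨abs_nonneg r, hr.le⟩
    have h1 := hff k |r| hm
    rw [← abs_of_nonneg (hfb k |r| hm).1, h1, hloc k r hr, abs_mul, abs_mul, abs_abs]
  have hgabs : ∀ x, g |x| = g x := by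
    intro x
    rcases abs_choice x with h | h <;> rw [h]
    exact heven x
  refine ⟨s, ?_, ?_, ?_, ?_⟩
  · rw [continuous_iff_continuousAt]
    intro r
    obtain ⟨k, hk⟩ := exists_nat_gt |r|
    have h1 : Continuous (fun x => x * hInt n (fun x => g (f k x)) |x|) :=
      continuous_id.mul ((continuous_hInt n (hfg k)).comp continuous_abs)
    refine h1.continuousAt.congr ?_
    have : ∀ᶠ x : ℝ in 𝓝 r, |x| < (k:ℝ) + 1 :=
      continuous_abs.continuousAt.eventually_lt continuousAt_const (by linarith)
    filter_upwards [this] with x hx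
    exact (hloc k x hx).symm
  · intro r
    obtain ⟨k, hk⟩ := exists_nat_gt |r|
    have hm : |r| ∈ Icc (0:ℝ) (k + 1) := ⟨abs_nonneg r, by linarith⟩
    have := (hfb k |r| hm).2
    rw [← habs k r (by linarith)] at this
    exact abs_lt.1 this
  · intro r hr
    obtain ⟨k, hk⟩ := exists_nat_gt |r|
    have hm : |r| ∈ Icc (0:ℝ) (k + 1) := ⟨abs_nonneg r, by linarith⟩
    have h1 := (hfb k |r| hm).1
    rw [hff k _ hm] at h1
    rw [hloc k r (by linarith)]
    rwa [abs_of_nonneg hr] at h1 ⊢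
  · intro r
    obtain ⟨k, hk⟩ := exists_nat_gt |r|
    rw [hloc k r (by linarith)]
    congr 1
    apply intervalIntegral.integral_congr
    intro t ht
    rw [uIcc_of_le zero_le_one] at ht
    have h1 : |t * r| = t * |r| := by rw [abs_mul, abs_of_nonneg ht.1]
    have h2 : t * |r| ≤ |r| := mul_le_of_le_one_left (abs_nonneg r) ht.2
    simp only
    rw [← hgabs (s (t * r)), habs k (t * r) (by rw [h1]; linarith), h1]

lemma global_props {n : ℕ} (hn : 1 ≤ n) {g : ℝ → ℝ} {a : ℝ} (hgc : Continuous g)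
    (hg : AntitoneOn g (Ici 0)) (hpos : ∀ x, 0 ≤ x → x < a → 0 < g x)
    (heven : ∀ x, g (-x) = g x)
    (hsm : ContDiffOn ℝ (⊤ : ℕ∞) g (Ioo (-a) a)) {s : ℝ → ℝ} (hsc : Continuous s)
    (hsa : ∀ r, s r ∈ Ioo (-a) a) (hs0 : ∀ r, 0 ≤ r → 0 ≤ s r)
    (hfix : ∀ r, s r = r * hInt n (fun x => g (s x)) r) :
    ContDiff ℝ (⊤ : ℕ∞) s ∧ (∀ r, 0 < r → 0 < s r) ∧ (∀ r, 0 < r → 0 < deriv s r) ∧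
      (∀ r, 0 < r → deriv s r = g (s r) - n * (s r / r)) ∧ Tendsto s atTop (𝓝 a) := by
  have hn' : (0:ℝ) < n := by exact_mod_cast hn
  have hsmooth := contDiff_of_fixed n hsm hsc hsa hfix
  have hFc : Continuous (fun x => g (s x)) := hgc.comp hsc
  have hgabs : ∀ x, g |x| = g x := by
    intro x
    rcases abs_choice x with h | h <;> rw [h]
    exact heven x
  have hFpos : ∀ x, 0 < g (s x) := by
    intro x
    rw [← hgabs]
    exact hpos _ (abs_nonneg _) (abs_lt.2 (hsa x))
  have hhpos : ∀ r, 0 < hInt n (fun x => g (s x)) r := by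
    intro r
    apply intervalIntegral.intervalIntegral_pos_of_pos_on
    · apply Continuous.intervalIntegrable; fun_prop
    · intro t ht
      exact mul_pos (pow_pos ht.1 _) (hFpos _)
    · exact zero_lt_one
  have hd : ∀ r, HasDerivAt s (g (s r) - n * hInt n (fun x => g (s x)) r) r := fun r =>
    (hasDerivAt_mul_hInt n hFc r).congr_of_eventuallyEq (Eventually.of_forall hfix)
  have hspos : ∀ r, 0 < r → 0 < s r := fun r hr => by
    rw [hfix r]; exact mul_pos hr (hhpos r)
  have hF1 : ContDiff ℝ 1 (fun x => g (s x)) :=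
    (hsm.of_le (by exact_mod_cast le_top)).comp_contDiff (hsmooth.of_le (by exact_mod_cast le_top)) hsa
  have hdeq : ∀ r, deriv s r = g (s r) - n * hInt n (fun x => g (s x)) r := fun r => (hd r).deriv
  have hq : ∀ r, HasDerivAt (deriv s) (deriv (deriv s) r) r := fun r => by
    have h3 : ContDiff ℝ 1 (deriv s) := by
      have : ContDiff ℝ (1 + 1) s := contDiff_infty.1 hsmooth 2
      exact (contDiff_succ_iff_deriv.1 this).2.2
    exact (h3.differentiable one_ne_zero r).hasDerivAt
  have hqc : Continuous (deriv s) := continuous_iff_continuousAt.2 fun r => (hq r).continuousAt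
  -- at a zero of the derivative, the second derivative is positive
  have hcross : ∀ r, 0 < r → deriv s r = 0 → 0 < deriv (deriv s) r := by
    intro r hr h0
    have hh := hasDerivAt_hInt n hF1 r
    set h' := hInt (n + 1) (deriv fun x => g (s x)) r
    have e1 : deriv s r = 1 * hInt n (fun x => g (s x)) r + r * h' := by
      have := (hasDerivAt_id r).mul hh
      exact ((this.congr_of_eventuallyEq (Eventually.of_forall hfix))).deriv
    have hgd : HasDerivAt g (deriv g (s r)) (s r) :=
      ((hsm.contDiffAt (Ioo_mem_nhds (hsa r).1 (hsa r).2)).differentiableAt (by simp)).hasDerivAt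
    have hFd : HasDerivAt (fun x => g (s x)) (deriv g (s r) * deriv s r) r :=
      hgd.comp r (hsmooth.differentiable (by simp) r).hasDerivAt
    have e2 : deriv (deriv s) r = deriv g (s r) * deriv s r - n * h' := by
      exact ((hFd.sub (hh.const_mul (n:ℝ))).congr_of_eventuallyEq
        (Eventually.of_forall hdeq)).deriv
    rw [e2, h0]
    rw [h0] at e1
    have h3 : h' < 0 := by
      by_contra hcon
      push Not at hcon
      have := hhpos r
      nlinarith [mul_nonneg hr.le hcon]
    nlinarith [mul_pos hn' (neg_pos.2 h3)]
  have hq0 : 0 < deriv s 0 := by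
    rw [hdeq, hInt_zero]
    have := hFpos 0
    have e : g (s 0) - n * (g (s 0) / (n + 1)) = g (s 0) / (n + 1) := by field_simp; ring
    rw [e]; positivity
  have hqnn : ∀ r, 0 ≤ r → 0 ≤ deriv s r := by
    intro r hr
    have := image_le_of_deriv_right_lt_deriv_boundary (a := 0) (b := r) (f := fun x => - deriv s x)
      (f' := fun x => - deriv (deriv s) x)
      (B := fun _ => 0) (B' := fun _ => 0) hqc.neg.continuousOn
      (fun x _ => (hq x).neg.hasDerivWithinAt) (by simpa using hq0.le)
      (fun x => hasDerivAt_const x 0) ?_ (x := r) ⟨hr, le_rfl⟩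
    · simpa using this
    · intro x hx hx0
      have hx0 : deriv s x = 0 := by simpa using hx0
      have hxp : 0 < x := by
        rcases hx.1.eq_or_lt with h | h
        · rw [← h] at hx0; exact absurd hx0 hq0.ne'
        · exact h
      simpa using hcross x hxp hx0
  have hqpos : ∀ r, 0 < r → 0 < deriv s r := by
    intro r hr
    refine (hqnn r hr.le).lt_of_ne' fun h0 => ?_
    have hmin : IsLocalMin (deriv s) r := by
      filter_upwards [Ioi_mem_nhds hr] with x hx
      rw [h0]; exact hqnn x (le_of_lt hx)
    exact (hcross r hr h0).ne' hmin.deriv_eq_zero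
  have hmono : MonotoneOn s (Ici 0) := by
    refine monotoneOn_of_deriv_nonneg (convex_Ici 0) hsc.continuousOn
      (hsmooth.differentiable (by simp)).differentiableOn ?_
    rw [interior_Ici]
    exact fun x hx => hqnn x (le_of_lt hx)
  refine ⟨hsmooth, hspos, hqpos, ?_, ?_⟩
  · intro r hr
    have h1 : s r / r = hInt n (fun x => g (s x)) r := by
      rw [div_eq_iff hr.ne', mul_comm]; exact hfix r
    rw [hdeq r, h1]
  · rw [tendsto_order]
    refine ⟨fun l hl => ?_, fun u hu => Eventually.of_forall fun r => (hsa r).2.trans hu⟩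
    obtain ⟨r₀, hr₀, hlr⟩ : ∃ r₀, 0 ≤ r₀ ∧ l < s r₀ := by
      by_contra hcon
      push Not at hcon
      have hl0 : 0 ≤ l := (hs0 0 le_rfl).trans (hcon 0 le_rfl)
      have hgl := hpos l hl0 hl
      have hlow : ∀ r, 0 ≤ r → g l / (n + 1) ≤ hInt n (fun x => g (s x)) r := by
        intro r hr
        have e : g l / (n + 1) = ∫ t in (0:ℝ)..1, t ^ n * g l := by
          rw [intervalIntegral.integral_mul_const, integral_pow]; simp; ring
        rw [e, hInt]
        apply intervalIntegral.integral_mono_on zero_le_one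
        · apply Continuous.intervalIntegrable; fun_prop
        · apply Continuous.intervalIntegrable; fun_prop
        · intro t ht
          have h1 : 0 ≤ t * r := mul_nonneg ht.1 hr
          exact mul_le_mul_of_nonneg_left (hg (hs0 _ h1) hl0 (hcon _ h1)) (pow_nonneg ht.1 _)
      set r := (l + 1) / (g l / (n + 1))
      have hr : 0 ≤ r := by positivity
      have h1 := hcon r hr
      rw [hfix r] at h1
      have h2 := mul_le_mul_of_nonneg_left (hlow r hr) hr
      have h3 : r * (g l / (n + 1)) = l + 1 := by
        simp only [r]; field_simp
      linarith
    filter_upwards [eventually_ge_atTop r₀] with r hr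
    exact hlr.trans_le (hmono hr₀ (hr₀.trans hr) hr)

lemma oddPow_of_nonneg {x : ℝ} (e : ℝ) (hx : 0 ≤ x) : oddPow x e = x ^ e := if_pos hx

lemma continuous_oddPow {e : ℝ} (he : 0 < e) : Continuous (fun x => oddPow x e) := by
  unfold oddPow
  refine Continuous.if_le (Real.continuous_rpow_const he.le)
    (((Real.continuous_rpow_const he.le).comp continuous_neg).neg) continuous_const continuous_id ?_
  intro x hx
  subst hx
  simp [Real.zero_rpow he.ne']

lemma monotone_oddPow {e : ℝ} (he : 0 < e) : Monotone (fun x => oddPow x e) := by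
  intro x y hxy
  simp only [oddPow]
  split_ifs with h1 h2 h2
  · exact Real.rpow_le_rpow h1 hxy he.le
  · exact absurd (h1.trans hxy) h2
  · push Not at h1
    have := Real.rpow_nonneg (neg_nonneg.2 h1.le) e
    have := Real.rpow_nonneg h2 e
    linarith
  · push Not at h1 h2
    exact neg_le_neg (Real.rpow_le_rpow (by linarith) (by linarith) he.le)

lemma hasDerivAt_sn (p : ℝ) :
    HasDerivAt (fun x => x / Real.sqrt (1 + x ^ 2)) (1 / Real.sqrt (1 + p ^ 2) ^ 3) p := by
  have hp : 0 < 1 + p ^ 2 := by positivity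
  have h1 : HasDerivAt (fun x : ℝ => 1 + x ^ 2) (2 * p) p := by
    simpa using (hasDerivAt_pow 2 p).const_add 1
  have h2 := (hasDerivAt_id p).div (h1.sqrt hp.ne') (Real.sqrt_pos.2 hp).ne'
  refine h2.congr_deriv ?_
  have hW := Real.sq_sqrt hp.le
  have hW0 := Real.sqrt_pos.2 hp
  set W := Real.sqrt (1 + p ^ 2)
  simp only [id]
  field_simp
  linarith

lemma hasDerivAt_tn {x : ℝ} (hx : 0 < 1 - x ^ 2) :
    HasDerivAt (fun x => x / Real.sqrt (1 - x ^ 2)) (1 / Real.sqrt (1 - x ^ 2) ^ 3) x := by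
  have h1 : HasDerivAt (fun x : ℝ => 1 - x ^ 2) (-(2 * x)) x := by
    simpa using (hasDerivAt_pow 2 x).const_sub 1
  have h2 := (hasDerivAt_id x).div (h1.sqrt hx.ne') (Real.sqrt_pos.2 hx).ne'
  refine h2.congr_deriv ?_
  have hW := Real.sq_sqrt hx.le
  have hW0 := Real.sqrt_pos.2 hx
  set W := Real.sqrt (1 - x ^ 2)
  simp only [id]
  field_simp
  linarith

lemma sqrt_one_sub_sn (p : ℝ) :
    Real.sqrt (1 - (p / Real.sqrt (1 + p ^ 2)) ^ 2) = 1 / Real.sqrt (1 + p ^ 2) := by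
  have hp : 0 < 1 + p ^ 2 := by positivity
  have e : 1 - (p / Real.sqrt (1 + p ^ 2)) ^ 2 = (1 / Real.sqrt (1 + p ^ 2)) ^ 2 := by
    rw [div_pow, div_pow, Real.sq_sqrt hp.le]; field_simp; ring
  rw [e, Real.sqrt_sq (by positivity)]

/-- The right-hand side in terms of `s = φ'/√(1+φ'²)`. -/
noncomputable def gFun (α b c x : ℝ) : ℝ := oddPow (c * Real.sqrt (1 - x ^ 2) - b) (1 / α)

/-- Properties of any solution in terms of `s = ψ'/√(1+ψ'²)`. -/
lemma sol_props {N : ℕ} (hN : 1 < N) {α b c : ℝ} (hgc : Continuous (gFun α b c))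
    (hg0 : 0 < gFun α b c 0) {S : ℝ} (hS : 0 < S) {ψ ψ' ψ'' : ℝ → ℝ}
    (h : IsProfileSolOn N α b c (Ico 0 S) ψ ψ' ψ'') :
    ContinuousOn (fun r => ψ' r / Real.sqrt (1 + ψ' r ^ 2)) (Ico 0 S) ∧
    (∀ r ∈ Ioo 0 S, HasDerivAt (fun x => x ^ (N - 1) * (ψ' x / Real.sqrt (1 + ψ' x ^ 2)))
      (r ^ (N - 1) * gFun α b c (ψ' r / Real.sqrt (1 + ψ' r ^ 2))) r) ∧
    (∀ r ∈ Ioo 0 S, 0 ≤ ψ' r / Real.sqrt (1 + ψ' r ^ 2)) := by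
  obtain ⟨_, h0, _, hd', hode⟩ := h
  obtain ⟨n, rfl⟩ : ∃ n, N = n + 1 := ⟨N - 1, by omega⟩
  have hn : 1 ≤ n := by omega
  simp only [Nat.add_sub_cancel]
  set s : ℝ → ℝ := fun r => ψ' r / Real.sqrt (1 + ψ' r ^ 2) with hs
  have hpc : ContinuousOn ψ' (Ico 0 S) := fun r hr => (hd' r hr).continuousWithinAt
  have hsc : ContinuousOn s (Ico 0 S) := by
    intro r hr
    exact ((hasDerivAt_sn (ψ' r)).continuousAt).comp_continuousWithinAt (hpc r hr)
  have hs0 : s 0 = 0 := by simp [hs, h0]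
  have hsd : ∀ r ∈ Ioo 0 S, HasDerivAt s (gFun α b c (s r) - n / r * s r) r := by
    intro r hr
    have h1 : HasDerivAt ψ' (ψ'' r) r :=
      (hd' r ⟨hr.1.le, hr.2⟩).hasDerivAt (Ico_mem_nhds hr.1 hr.2)
    refine ((hasDerivAt_sn (ψ' r)).comp r h1).congr_deriv ?_
    have h2 := hode r ⟨hr.1.le, hr.2⟩ hr.1.ne'
    have hp : 0 < 1 + ψ' r ^ 2 := by positivity
    have hW0 := Real.sqrt_pos.2 hp
    have hW := Real.sq_sqrt hp.le
    simp only [gFun, hs, sqrt_one_sub_sn, mul_one_div]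
    rw [← hW, Real.sqrt_sq hW0.le] at h2
    set W := Real.sqrt (1 + ψ' r ^ 2)
    set Q := oddPow (c / W - b) (1 / α)
    have h3 : Q = (ψ'' r / W ^ 2 + (((n + 1 : ℕ) : ℝ) - 1) / r * ψ' r) / W := by
      rw [h2]; field_simp
    rw [h3]
    push_cast
    have := hr.1
    field_simp
    ring
  have hwd : ∀ r ∈ Ioo 0 S, HasDerivAt (fun x => x ^ n * s x) (r ^ n * gFun α b c (s r)) r := by
    intro r hr
    refine ((hasDerivAt_pow n r).mul (hsd r hr)).congr_deriv ?_
    obtain ⟨m, rfl⟩ : ∃ m, n = m + 1 := ⟨n - 1, by omega⟩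
    have := hr.1
    simp only [Nat.add_sub_cancel]
    field_simp
    ring
  refine ⟨hsc, hwd, ?_⟩
  -- positivity near zero
  obtain ⟨δ, hδ0, hδS, hδ⟩ : ∃ δ, 0 < δ ∧ δ ≤ S ∧ ∀ r ∈ Ico 0 δ, 0 < gFun α b c (s r) := by
    have h1 : ContinuousWithinAt (fun r => gFun α b c (s r)) (Ico 0 S) 0 :=
      hgc.continuousAt.comp_continuousWithinAt (hsc 0 ⟨le_rfl, hS⟩)
    have h2 : ∀ᶠ r in 𝓝[Ico 0 S] 0, 0 < gFun α b c (s r) :=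
      h1.eventually (lt_mem_nhds (by simpa [hs0] using hg0))
    rw [eventually_nhdsWithin_iff, Metric.eventually_nhds_iff] at h2
    obtain ⟨ε, hε, h3⟩ := h2
    refine ⟨min ε S, lt_min hε hS, min_le_right _ _, fun r hr => ?_⟩
    refine h3 ?_ ⟨hr.1, hr.2.trans_le (min_le_right _ _)⟩
    rw [Real.dist_eq, sub_zero, abs_of_nonneg hr.1]
    exact hr.2.trans_le (min_le_left _ _)
  have hnear : ∀ r ∈ Ioo 0 δ, 0 < s r := by
    have hmono : StrictMonoOn (fun x => x ^ n * s x) (Ico 0 δ) := by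
      refine strictMonoOn_of_deriv_pos (convex_Ico 0 δ) ?_ ?_
      · exact (continuous_pow n).continuousOn.mul (hsc.mono (Ico_subset_Ico_right hδS))
      · rw [interior_Ico]
        intro r hr
        rw [(hwd r ⟨hr.1, hr.2.trans_le hδS⟩).deriv]
        exact mul_pos (pow_pos hr.1 _) (hδ r ⟨hr.1.le, hr.2⟩)
    intro r hr
    have := hmono ⟨le_rfl, hδ0⟩ ⟨hr.1.le, hr.2⟩ hr.1
    simp only [hs0, mul_zero] at this
    exact (mul_pos_iff_of_pos_left (pow_pos hr.1 n)).1 this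
  intro r hr
  by_cases hrδ : r < δ
  · exact (hnear r ⟨hr.1, hrδ⟩).le
  push Not at hrδ
  have hsub : ∀ x ∈ Icc (δ / 2) r, x ∈ Ioo 0 S := fun x hx =>
    ⟨by linarith [hx.1], hx.2.trans_lt hr.2⟩
  have := image_le_of_deriv_right_lt_deriv_boundary (a := δ / 2) (b := r) (f := fun x => - s x)
      (f' := fun x => - (gFun α b c (s x) - n / x * s x))
      (B := fun _ => 0) (B' := fun _ => 0)
      (hsc.mono fun x hx => ⟨(hsub x hx).1.le, (hsub x hx).2⟩).neg
      (fun x hx => (hsd x (hsub x ⟨hx.1, hx.2.le⟩)).neg.hasDerivWithinAt)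
      (by simpa using (hnear (δ / 2) ⟨by linarith, by linarith⟩).le)
      (fun x => hasDerivAt_const x 0) ?_ (x := r) ⟨by linarith, le_rfl⟩
  · simpa using this
  · intro x hx hx0
    have hx0 : s x = 0 := by simpa using hx0
    simp only [hx0]
    simpa using hg0

/-- for `c > b > 0`, the translating-profile problem has a unique solution,
defined and `C^∞` on all of `[0, ∞)`, with `Φ' > 0`, `Φ'' > 0` on `(0, ∞)` and
`Φ'(r) → √(c²−b²)/b` as `r → ∞`. -/
theorem stmt7 (N : ℕ) (hN : 1 < N) (α b c : ℝ) (hα : 0 < α) (hb : 0 < b) (hc : b < c) :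
    ∃ φ φ' φ'' : ℝ → ℝ,
      IsProfileSolOn N α b c (Set.Ici 0) φ φ' φ'' ∧
      (∀ (S : ℝ) (ψ ψ' ψ'' : ℝ → ℝ), 0 < S →
        IsProfileSolOn N α b c (Set.Ico 0 S) ψ ψ' ψ'' → Set.EqOn ψ φ (Set.Ico 0 S)) ∧
      ContDiffOn ℝ (⊤ : ℕ∞) φ (Set.Ici 0) ∧
      (∀ r : ℝ, 0 < r → 0 < φ' r ∧ 0 < φ'' r) ∧
      Filter.Tendsto φ' Filter.atTop (nhds (Real.sqrt (c ^ 2 - b ^ 2) / b)) := by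
  have hc0 : 0 < c := hb.trans hc
  have he : 0 < 1 / α := by positivity
  have hcb : 0 < c ^ 2 - b ^ 2 := by nlinarith
  set a : ℝ := Real.sqrt (c ^ 2 - b ^ 2) / c with ha_def
  have ha : 0 < a := div_pos (Real.sqrt_pos.2 hcb) hc0
  have hasq : a ^ 2 = (c ^ 2 - b ^ 2) / c ^ 2 := by rw [ha_def, div_pow, Real.sq_sqrt hcb.le]
  have h1a : 1 - a ^ 2 = (b / c) ^ 2 := by rw [hasq]; field_simp; ring
  have hsqa : Real.sqrt (1 - a ^ 2) = b / c := by rw [h1a, Real.sqrt_sq (by positivity)]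
  have hlt : ∀ x, |x| < a → (b / c) ^ 2 < 1 - x ^ 2 := by
    intro x hx
    have : x ^ 2 < a ^ 2 := by
      rw [← sq_abs x]; exact pow_lt_pow_left₀ hx (abs_nonneg x) two_ne_zero
    linarith
  have hargpos : ∀ x, |x| < a → 0 < c * Real.sqrt (1 - x ^ 2) - b := by
    intro x hx
    have h1 : b / c < Real.sqrt (1 - x ^ 2) := Real.lt_sqrt_of_sq_lt (hlt x hx)
    rw [div_lt_iff₀ hc0] at h1
    linarith
  have hgc : Continuous (gFun α b c) := by
    have h1 : Continuous (fun x : ℝ => c * Real.sqrt (1 - x ^ 2) - b) := by fun_prop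
    exact (continuous_oddPow he).comp h1
  have hanti : AntitoneOn (gFun α b c) (Ici 0) := by
    intro x hx y hy hxy
    refine monotone_oddPow he ?_
    have h1 : x ^ 2 ≤ y ^ 2 := pow_le_pow_left₀ hx hxy 2
    have h2 : Real.sqrt (1 - y ^ 2) ≤ Real.sqrt (1 - x ^ 2) := Real.sqrt_le_sqrt (by linarith)
    have h3 := mul_le_mul_of_nonneg_left h2 hc0.le
    linarith
  have hgpos : ∀ x, 0 ≤ x → x < a → 0 < gFun α b c x := by
    intro x hx hxa
    have h1 := hargpos x (by rwa [abs_of_nonneg hx])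
    rw [gFun, oddPow_of_nonneg _ h1.le]
    exact Real.rpow_pos_of_pos h1 _
  have hga : gFun α b c a = 0 := by
    rw [gFun, hsqa, mul_div_cancel₀ _ hc0.ne', sub_self, oddPow_of_nonneg _ le_rfl,
      Real.zero_rpow he.ne']
  have heven : ∀ x, gFun α b c (-x) = gFun α b c x := by intro x; simp [gFun]
  have hsm : ContDiffOn ℝ (⊤ : ℕ∞) (gFun α b c) (Ioo (-a) a) := by
    have h1 : ContDiffOn ℝ (⊤ : ℕ∞) (fun x : ℝ => (c * Real.sqrt (1 - x ^ 2) - b) ^ (1 / α))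
        (Ioo (-a) a) := by
      refine ContDiffOn.rpow_const_of_ne ?_ fun x hx => (hargpos x (abs_lt.2 hx)).ne'
      refine (contDiffOn_const.mul (ContDiffOn.sqrt ?_ ?_)).sub contDiffOn_const
      · exact (contDiff_const.sub (contDiff_id.pow 2)).contDiffOn
      · intro x hx
        have := hlt x (abs_lt.2 hx)
        have h0 : 0 < (b / c) ^ 2 := by positivity
        exact (h0.trans this).ne'
    exact h1.congr fun x hx => oddPow_of_nonneg _ (hargpos x (abs_lt.2 hx)).le
  obtain ⟨n, rfl⟩ : ∃ n, N = n + 1 := ⟨N - 1, by omega⟩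
  have hn : 1 ≤ n := by omega
  obtain ⟨s, hsc, hsa, hs0, hfix⟩ := exists_global hn ha hgc hanti hgpos hga heven hsm
  obtain ⟨hss, hspos, hsdpos, hsode, hslim⟩ :=
    global_props hn hgc hanti hgpos heven hsm hsc hsa hs0 hfix
  have hsz : s 0 = 0 := by rw [hfix 0, zero_mul]
  have hpos1 : ∀ r, 0 < 1 - s r ^ 2 := by
    intro r
    have h0 : 0 < (b / c) ^ 2 := by positivity
    exact h0.trans (hlt _ (abs_lt.2 (hsa r)))
  set p : ℝ → ℝ := fun r => s r / Real.sqrt (1 - s r ^ 2) with hp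
  have hpsm : ContDiff ℝ (⊤ : ℕ∞) p :=
    hss.div ((contDiff_const.sub (hss.pow 2)).sqrt fun r => (hpos1 r).ne')
      fun r => (Real.sqrt_pos.2 (hpos1 r)).ne'
  have hsd : ∀ r, HasDerivAt s (deriv s r) r := fun r =>
    (hss.differentiable (by simp) r).hasDerivAt
  have hpd : ∀ r, HasDerivAt p (1 / Real.sqrt (1 - s r ^ 2) ^ 3 * deriv s r) r := fun r =>
    (hasDerivAt_tn (hpos1 r)).comp r (hsd r)
  have hpc : Continuous p := hpsm.continuous
  have hp1 : ∀ r, Real.sqrt (1 + p r ^ 2) = 1 / Real.sqrt (1 - s r ^ 2) := by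
    intro r
    have h0 := hpos1 r
    have e : 1 + p r ^ 2 = (1 / Real.sqrt (1 - s r ^ 2)) ^ 2 := by
      simp only [hp]
      rw [div_pow, div_pow, Real.sq_sqrt h0.le]; field_simp; ring
    rw [e, Real.sqrt_sq (by positivity)]
  have hps : ∀ r, p r / Real.sqrt (1 + p r ^ 2) = s r := by
    intro r
    have := Real.sqrt_pos.2 (hpos1 r)
    rw [hp1]; simp only [hp]; field_simp
  set φ : ℝ → ℝ := fun r => ∫ u in (0:ℝ)..r, p u with hφ
  have hφd : ∀ r, HasDerivAt φ (p r) r := fun r =>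
    intervalIntegral.integral_hasDerivAt_right (hpc.intervalIntegrable _ _)
      hpc.aestronglyMeasurable.stronglyMeasurableAtFilter hpc.continuousAt
  have hφ0 : φ 0 = 0 := by simp [hφ]
  refine ⟨φ, p, fun r => 1 / Real.sqrt (1 - s r ^ 2) ^ 3 * deriv s r, ?_, ?_, ?_, ?_, ?_⟩
  · refine ⟨hφ0, by simp [hp, hsz], fun r _ => (hφd r).hasDerivWithinAt,
      fun r _ => (hpd r).hasDerivWithinAt, ?_⟩
    intro r hr hr0
    have hr : 0 < r := lt_of_le_of_ne hr (Ne.symm hr0)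
    have hV0 := Real.sqrt_pos.2 (hpos1 r)
    have e1 : 1 + p r ^ 2 = (1 / Real.sqrt (1 - s r ^ 2)) ^ 2 := by
      rw [← hp1, Real.sq_sqrt (by positivity)]
    have e2 : oddPow (c / Real.sqrt (1 + p r ^ 2) - b) (1 / α) = gFun α b c (s r) := by
      rw [hp1, gFun, div_div_eq_mul_div, div_one]
    rw [e2, hp1, e1]
    simp only [hp, hsode r hr]
    set V := Real.sqrt (1 - s r ^ 2)
    push_cast
    field_simp
    ring
  · intro S ψ ψ' ψ'' hS hψ
    obtain ⟨h1, h2, h3⟩ := sol_props hN hgc (hgpos 0 le_rfl ha) hS hψ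
    have h4 := uniq_aux hn hanti h1 hsc.continuousOn h3 (fun r hr => hs0 r hr.1.le) h2
      (fun r hr => hasDerivAt_pow_mul_of_fixed (g := gFun α b c) (s := s) (hgc.comp hsc) (R := S) (fun r _ => hfix r) r hr)
    have h5 : ∀ r ∈ Ico 0 S, ψ' r = p r := by
      intro r hr
      rcases hr.1.eq_or_lt with h | h
      · rw [← h, hψ.2.1]; simp [hp, hsz]
      · have h6 := h4 r ⟨h, hr.2⟩
        have hW : 0 < Real.sqrt (1 + ψ' r ^ 2) := Real.sqrt_pos.2 (by positivity)
        simp only [hp]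
        rw [← h6, sqrt_one_sub_sn]
        field_simp
    intro r hr
    have hdiff : ∀ x ∈ Ico 0 S, HasDerivWithinAt (fun y => ψ y - φ y) 0 (Ico 0 S) x := by
      intro x hx
      have := (hψ.2.2.1 x hx).sub (hφd x).hasDerivWithinAt
      rw [h5 x hx, sub_self] at this
      exact this
    have h7 := (convex_Ico (0:ℝ) S).norm_image_sub_le_of_norm_hasDerivWithin_le (C := 0) hdiff
      (fun x _ => by simp) (left_mem_Ico.2 hS) hr
    simp only [zero_mul, hψ.1, hφ0, sub_self, sub_zero] at h7
    exact sub_eq_zero.1 (norm_le_zero_iff.1 h7)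
  · have : ContDiff ℝ (⊤ : ℕ∞) φ := by
      rw [contDiff_infty_iff_deriv]
      refine ⟨fun r => (hφd r).differentiableAt, ?_⟩
      rw [show deriv φ = p from funext fun r => (hφd r).deriv]
      exact hpsm
    exact this.contDiffOn
  · intro r hr
    have hV0 := Real.sqrt_pos.2 (hpos1 r)
    exact ⟨div_pos (hspos r hr) hV0, mul_pos (by positivity) (hsdpos r hr)⟩
  · have h1 : ContinuousAt (fun x => x / Real.sqrt (1 - x ^ 2)) a :=
      (hasDerivAt_tn (by rw [h1a]; positivity)).continuousAt
    have h2 := h1.tendsto.comp hslim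
    have e : a / Real.sqrt (1 - a ^ 2) = Real.sqrt (c ^ 2 - b ^ 2) / b := by
      rw [hsqa, ha_def]; field_simp
    rw [e] at h2
    exact h2
end

section
/- Let N > 1 be an integer, α > 0, b < 0 < k, and assume (−b)^{1/α}·√(1+k²) < k·N. Then there exists a unique c̃ > 0 such that the maximal existence interval of the translating profile Φ(·; c̃, b) contains [0, 1] and Φ'(1; c̃, b) = k. -/
open Set Filter Topology

lemma cmp_aux (m : ℕ) (S : ℝ) (w1 w2 A1 A2 : ℝ → ℝ)
    (h1c : ContinuousOn w1 (Ico 0 S)) (h2c : ContinuousOn w2 (Ico 0 S)) (h0 : w1 0 = w2 0)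
    (h1 : ∀ r ∈ Ioo 0 S, HasDerivAt w1 (A1 r - m * w1 r / r) r)
    (h2 : ∀ r ∈ Ioo 0 S, HasDerivAt w2 (A2 r - m * w2 r / r) r)
    (hA : ∀ r ∈ Ioo 0 S, w2 r < w1 r → A1 r ≤ A2 r) :
    ∀ r ∈ Ico 0 S, w1 r ≤ w2 r := by
  intro r0 hr0
  by_contra! hlt
  have hr0pos : 0 < r0 := by
    rcases eq_or_lt_of_le hr0.1 with h | h
    · rw [← h, h0] at hlt; exact absurd hlt (lt_irrefl _)
    · exact h
  set D : ℝ → ℝ := fun r => r ^ m * (w2 r - w1 r) with hD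
  have hsub : Icc 0 r0 ⊆ Ico 0 S := fun x hx => ⟨hx.1, hx.2.trans_lt hr0.2⟩
  have hDc : ContinuousOn D (Icc 0 r0) :=
    ((continuous_pow m).continuousOn).mul ((h2c.mono hsub).sub (h1c.mono hsub))
  have hDd : ∀ r ∈ Ioo 0 S, HasDerivAt D (r ^ m * (A2 r - A1 r)) r := by
    intro r hr
    have hp := (hasDerivAt_pow m r).mul ((h2 r hr).sub (h1 r hr))
    refine hp.congr_deriv ?_
    have hr' : r ≠ 0 := hr.1.ne'
    rcases m with _ | m
    · simp
    · simp only [Nat.add_sub_cancel, Pi.sub_apply]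
      field_simp
      ring
  have hK : IsCompact (Icc 0 r0 ∩ D ⁻¹' (Ici 0)) :=
    (isCompact_Icc).of_isClosed_subset (hDc.preimage_isClosed_of_isClosed isClosed_Icc isClosed_Ici)
      inter_subset_left
  have hne : (Icc 0 r0 ∩ D ⁻¹' (Ici 0)).Nonempty :=
    ⟨0, ⟨le_refl _, hr0pos.le⟩, by simp [hD, h0]⟩
  obtain ⟨s, ⟨hs1, hs2⟩, hsmax⟩ := hK.exists_isGreatest hne
  have hDr0 : D r0 < 0 := mul_neg_of_pos_of_neg (pow_pos hr0pos m) (by linarith)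
  have hmono : MonotoneOn D (Icc s r0) := by
    apply monotoneOn_of_deriv_nonneg (convex_Icc _ _)
    · exact hDc.mono (Icc_subset_Icc_left hs1.1)
    · rw [interior_Icc]
      intro x hx
      exact (hDd x ⟨hs1.1.trans_lt hx.1, hx.2.trans hr0.2⟩).differentiableAt.differentiableWithinAt
    · rw [interior_Icc]
      intro x hx
      have hxm : x ∈ Ioo 0 S := ⟨hs1.1.trans_lt hx.1, hx.2.trans hr0.2⟩
      rw [(hDd x hxm).deriv]
      have hDx : D x < 0 := by
        by_contra! h
        have := hsmax ⟨⟨hxm.1.le, hx.2.le⟩, h⟩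
        linarith [hx.1]
      have hlt : w2 x < w1 x := by
        by_contra! h
        have : 0 ≤ D x := mul_nonneg (pow_nonneg hxm.1.le m) (by linarith)
        linarith
      exact mul_nonneg (pow_nonneg hxm.1.le m) (by linarith [hA x hxm hlt])
  have := hmono ⟨le_refl _, hs1.2⟩ ⟨hs1.2, le_refl _⟩ hs1.2
  have hs2' : 0 ≤ D s := hs2
  linarith

lemma exists_aux (m : ℕ) (L : NNReal) (g : ℝ → ℝ) (hg : LipschitzWith L g) :
    ∃ w : ℝ → ℝ, Continuous w ∧ w 0 = 0 ∧ HasDerivAt w (g 0 / (m + 1)) 0 ∧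
      ∀ r ∈ Ioo (0:ℝ) 2, HasDerivAt w (g (w r) - m * w r / r) r := by
  have h02 : (0:ℝ) ≤ 2 := by norm_num
  set l : ℝ := L + 1 with hl
  have hlpos : 0 < l := by positivity
  let h : C(Icc (0:ℝ) 2, ℝ) → ℝ → ℝ := fun y s => g (Real.exp (l * s) * IccExtend h02 y s)
  have hhc : ∀ y, Continuous (h y) := by
    intro y
    have : Continuous (IccExtend h02 y) := y.continuous.Icc_extend'
    exact hg.continuous.comp (by fun_prop)
  let W : C(Icc (0:ℝ) 2, ℝ) → ℝ → ℝ := fun y r => ∫ t in (0:ℝ)..1, t ^ m * h y (t * r)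
  have hWc : ∀ y, Continuous (W y) := by
    intro y
    have := hhc y
    apply intervalIntegral.continuous_parametric_intervalIntegral_of_continuous'
    fun_prop
  let T : C(Icc (0:ℝ) 2, ℝ) → C(Icc (0:ℝ) 2, ℝ) := fun y =>
    ⟨fun r => Real.exp (-(l * r)) * (r * W y r), by
      have := hWc y
      fun_prop⟩
  have hexpint : ∀ r : ℝ, r * ∫ t in (0:ℝ)..1, Real.exp (l * (t * r)) = (Real.exp (l * r) - 1) / l := by
    intro r
    rw [← intervalIntegral.integral_const_mul]
    have := intervalIntegral.integral_eq_sub_of_hasDerivAt (a := 0) (b := 1)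
      (f := fun t => Real.exp (l * (t * r)) / l) (f' := fun t => r * Real.exp (l * (t * r)))
      (fun t _ => by
        have h1 : HasDerivAt (fun t : ℝ => l * (t * r)) (l * r) t := by
          simpa using ((hasDerivAt_id t).mul_const r).const_mul l
        refine (h1.exp.div_const l).congr_deriv ?_
        field_simp)
      (Continuous.intervalIntegrable (by fun_prop) _ _)
    rw [this]
    simp
    ring
  have hdist : ∀ y1 y2, dist (T y1) (T y2) ≤ (L / l) * dist y1 y2 := by
    intro y1 y2
    rw [ContinuousMap.dist_le (by positivity)]
    rintro ⟨r, hr⟩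
    have hc1 := hhc y1
    have hc2 := hhc y2
    have hWd : |W y1 r - W y2 r| ≤ (L * dist y1 y2) * ∫ t in (0:ℝ)..1, Real.exp (l * (t * r)) := by
      simp only [W]
      rw [← intervalIntegral.integral_sub (Continuous.intervalIntegrable (by fun_prop) _ _)
        (Continuous.intervalIntegrable (by fun_prop) _ _), ← intervalIntegral.integral_const_mul]
      rw [← Real.norm_eq_abs]
      apply intervalIntegral.norm_integral_le_of_norm_le zero_le_one
      · refine Eventually.of_forall fun t ht => ?_
        rw [← mul_sub, norm_mul]
        have e1 : ‖t ^ m‖ ≤ 1 := by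
          rw [Real.norm_eq_abs, abs_of_nonneg (pow_nonneg ht.1.le m)]
          exact pow_le_one₀ ht.1.le ht.2
        have e2 : ‖h y1 (t * r) - h y2 (t * r)‖ ≤ L * dist y1 y2 * Real.exp (l * (t * r)) := by
          have := hg.dist_le_mul (Real.exp (l * (t * r)) * IccExtend h02 y1 (t * r))
            (Real.exp (l * (t * r)) * IccExtend h02 y2 (t * r))
          rw [dist_eq_norm] at this
          refine this.trans ?_
          rw [mul_assoc]
          refine mul_le_mul_of_nonneg_left ?_ L.2
          rw [Real.dist_eq, ← mul_sub, abs_mul, abs_of_pos (Real.exp_pos _), mul_comm]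
          refine mul_le_mul_of_nonneg_right ?_ (Real.exp_pos _).le
          rw [← Real.dist_eq]
          exact ContinuousMap.dist_apply_le_dist _
        calc _ ≤ 1 * (L * dist y1 y2 * Real.exp (l * (t * r))) :=
              mul_le_mul e1 e2 (norm_nonneg _) zero_le_one
          _ = _ := one_mul _
      · exact Continuous.intervalIntegrable (by fun_prop) _ _
    change dist (Real.exp (-(l * r)) * (r * W y1 r)) (Real.exp (-(l * r)) * (r * W y2 r)) ≤ _
    rw [Real.dist_eq, ← mul_sub, ← mul_sub, abs_mul, abs_mul, abs_of_pos (Real.exp_pos _),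
      abs_of_nonneg hr.1]
    calc Real.exp (-(l * r)) * (r * |W y1 r - W y2 r|)
        ≤ Real.exp (-(l * r)) * (r * ((L * dist y1 y2) * ∫ t in (0:ℝ)..1, Real.exp (l * (t * r)))) := by
          have := hr.1
          gcongr
      _ = Real.exp (-(l * r)) * ((L * dist y1 y2) * (r * ∫ t in (0:ℝ)..1, Real.exp (l * (t * r)))) := by
          ring
      _ = Real.exp (-(l * r)) * ((L * dist y1 y2) * ((Real.exp (l * r) - 1) / l)) := by rw [hexpint]
      _ = (L / l) * dist y1 y2 * (1 - Real.exp (-(l * r))) := by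
          rw [Real.exp_neg]
          field_simp
      _ ≤ (L / l) * dist y1 y2 * 1 := by
          gcongr
          linarith [Real.exp_pos (-(l * r))]
      _ = _ := mul_one _
  have hcontr : ContractingWith (L / (L + 1)) T := by
    refine ⟨?_, LipschitzWith.of_dist_le_mul ?_⟩
    · rw [div_lt_one (by positivity)]
      exact lt_add_one L
    · intro y1 y2
      simpa [hl] using hdist y1 y2
  set y := hcontr.fixedPoint T with hy
  have hfix : T y = y := hcontr.fixedPoint_isFixedPt
  have hcW := hWc y
  have hch := hhc y
  have hwy : ∀ r ∈ Icc (0:ℝ) 2, r * W y r = Real.exp (l * r) * IccExtend h02 y r := by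
    intro r hr
    rw [IccExtend_of_mem _ _ hr]
    have := congrArg (fun z : C(Icc (0:ℝ) 2, ℝ) => z ⟨r, hr⟩) hfix
    rw [← this]
    change _ = Real.exp (l * r) * (Real.exp (-(l * r)) * (r * W y r))
    rw [← mul_assoc, ← Real.exp_add]
    simp
  have hhw : ∀ r ∈ Icc (0:ℝ) 2, h y r = g (r * W y r) := by
    intro r hr
    rw [hwy r hr]
  have hI : ∀ r : ℝ, r ^ m * (r * W y r) = ∫ s in (0:ℝ)..r, s ^ m * h y s := by
    intro r
    have := intervalIntegral.mul_integral_comp_mul_right (a := 0) (b := 1)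
      (f := fun s => s ^ m * h y s) r
    rw [zero_mul, one_mul] at this
    rw [← this]
    simp only [W]
    rw [← mul_assoc, mul_comm (r ^ m) r, mul_assoc, ← intervalIntegral.integral_const_mul]
    congr 2
    ext t
    rw [mul_pow]; ring
  refine ⟨fun r => r * W y r, by fun_prop, by simp, ?_, ?_⟩
  · have hW0 : W y 0 = g 0 / (m + 1) := by
      simp only [W, mul_zero]
      rw [intervalIntegral.integral_mul_const, integral_pow, hhw 0 ⟨le_refl _, h02⟩]
      simp
      ring
    rw [← hW0, hasDerivAt_iff_tendsto_slope]
    refine ((hcW.tendsto 0).mono_left nhdsWithin_le_nhds).congr' ?_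
    filter_upwards [self_mem_nhdsWithin] with r hr
    have hr : r ≠ 0 := hr
    simp [slope_def_field, hr]
  · intro r hr
    have hd : HasDerivAt (fun r => ∫ s in (0:ℝ)..r, s ^ m * h y s) (r ^ m * h y r) r :=
      intervalIntegral.integral_hasDerivAt_right (Continuous.intervalIntegrable (by fun_prop) _ _)
        (Continuous.stronglyMeasurableAtFilter (by fun_prop) _ _) (by fun_prop)
    have hr0 : r ≠ 0 := hr.1.ne'
    have hq := hd.div (hasDerivAt_pow m r) (pow_ne_zero m hr0)
    refine (hq.congr_of_eventuallyEq ?_).congr_deriv ?_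
    · filter_upwards [lt_mem_nhds hr.1] with s hs
      simp only [Pi.div_apply]
      rw [← hI s, mul_div_cancel_left₀ _ (pow_ne_zero m hs.ne')]
    · rw [← hI r, hhw r ⟨hr.1.le, hr.2.le⟩]
      rcases m with _ | m
      · simp
      · simp only [Nat.add_sub_cancel]
        field_simp
        ring

noncomputable def GG (p β c x : ℝ) : ℝ := (c * Real.sqrt (1 - x ^ 2) + β) ^ p

noncomputable def clampK (κ x : ℝ) : ℝ := max 0 (min x κ)

def WSol (m : ℕ) (G : ℝ → ℝ) (S : ℝ) (w : ℝ → ℝ) : Prop :=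
  w 0 = 0 ∧ ContinuousOn w (Ico 0 S) ∧ ∀ r ∈ Ioo 0 S, HasDerivAt w (G (w r) - m * w r / r) r

lemma GG_anti {p β c : ℝ} (hp : 0 < p) (hβ : 0 < β) (hc : 0 ≤ c) : AntitoneOn (GG p β c) (Ici 0) := by
  intro x hx y hy hxy
  have hx : 0 ≤ x := hx
  apply Real.rpow_le_rpow (by positivity) _ hp.le
  gcongr

lemma GG_lower {p β c : ℝ} (hp : 0 < p) (hβ : 0 < β) (hc : 0 ≤ c) (x : ℝ) : β ^ p ≤ GG p β c x := by
  apply Real.rpow_le_rpow hβ.le _ hp.le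
  have : 0 ≤ c * Real.sqrt (1 - x ^ 2) := by positivity
  linarith

lemma GG_mono_c {p β c d : ℝ} (hp : 0 < p) (hβ : 0 < β) (hc : 0 ≤ c) (hcd : c ≤ d) (x : ℝ) :
    GG p β c x ≤ GG p β d x := by
  apply Real.rpow_le_rpow (by positivity) _ hp.le
  gcongr

lemma clampK_mono (κ : ℝ) : Monotone (clampK κ) := by
  intro x y hxy
  unfold clampK
  gcongr

lemma clampK_mem {κ : ℝ} (hκ : 0 ≤ κ) (x : ℝ) : clampK κ x ∈ Icc 0 κ :=
  ⟨le_max_left _ _, max_le hκ (min_le_right _ _)⟩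

lemma clampK_eq {κ x : ℝ} (h0 : 0 ≤ x) (h : x ≤ κ) : clampK κ x = x := by
  unfold clampK
  rw [min_eq_left h, max_eq_right h0]

lemma clampK_lip (κ : ℝ) : LipschitzWith 1 (clampK κ) :=
  (LipschitzWith.id.min_const κ).const_max 0

lemma GGc_anti {p β c κ : ℝ} (hp : 0 < p) (hβ : 0 < β) (hc : 0 ≤ c) :
    Antitone (fun x => GG p β c (clampK κ x)) := by
  intro x y hxy
  exact GG_anti hp hβ hc (mem_Ici.2 (le_max_left _ _)) (mem_Ici.2 (le_max_left _ _))
    (clampK_mono κ hxy)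

lemma GGc_lip {p β c κ : ℝ} (hβ : 0 < β) (hc : 0 ≤ c) (hκ0 : 0 ≤ κ) (hκ : κ < 1) :
    ∃ L, LipschitzWith L (fun x => GG p β c (clampK κ x)) := by
  have hcd : ContDiffOn ℝ 1 (GG p β c) (Icc 0 κ) := by
    intro x hx
    have h1 : 1 - x ^ 2 ≠ 0 := by nlinarith [hx.1, hx.2]
    have h2 : c * Real.sqrt (1 - x ^ 2) + β ≠ 0 := by positivity
    apply ContDiffAt.contDiffWithinAt
    unfold GG
    refine ContDiffAt.rpow_const_of_ne (f := fun x => c * Real.sqrt (1 - x ^ 2) + β) ?_ h2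
    have : ContDiffAt ℝ 1 (fun x : ℝ => Real.sqrt (1 - x ^ 2)) x :=
      ContDiffAt.sqrt (by fun_prop) h1
    fun_prop
  obtain ⟨L, hL⟩ := hcd.exists_lipschitzOnWith one_ne_zero (convex_Icc 0 κ) isCompact_Icc
  refine ⟨L * 1, ?_⟩
  rw [← lipschitzOnWith_univ]
  exact hL.comp ((clampK_lip κ).lipschitzOnWith) (fun x _ => clampK_mem hκ0 x)

lemma WSol.mono {m : ℕ} {G : ℝ → ℝ} {S S' : ℝ} {w : ℝ → ℝ} (h : WSol m G S w) (hS : S' ≤ S) :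
    WSol m G S' w :=
  ⟨h.1, h.2.1.mono (Ico_subset_Ico_right hS), fun r hr => h.2.2 r (Ioo_subset_Ioo_right hS hr)⟩

lemma lin_deriv (m : ℕ) (a r : ℝ) (hr : r ≠ 0) :
    HasDerivAt (fun r : ℝ => a / (m + 1) * r) (a - m * (a / (m + 1) * r) / r) r := by
  have := (hasDerivAt_id r).const_mul (a / (m + 1))
  refine this.congr_deriv ?_
  have : (m : ℝ) + 1 ≠ 0 := by positivity
  field_simp
  ring

lemma WSol.lower {m : ℕ} {G : ℝ → ℝ} {S a : ℝ} {w : ℝ → ℝ} (h : WSol m G S w)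
    (hG : ∀ x, a ≤ G x) : ∀ r ∈ Ico 0 S, a / (m + 1) * r ≤ w r := by
  apply cmp_aux m S _ w (fun _ => a) (fun r => G (w r)) (by fun_prop) h.2.1 (by simp [h.1]) _ h.2.2
  · intro r hr _
    exact hG _
  · intro r hr
    exact lin_deriv m a r hr.1.ne'

lemma WSol.nonneg {m : ℕ} {G : ℝ → ℝ} {S : ℝ} {w : ℝ → ℝ} (h : WSol m G S w)
    (hG : ∀ x, 0 ≤ G x) : ∀ r ∈ Ico 0 S, 0 ≤ w r := by
  intro r hr
  simpa using h.lower hG r hr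

lemma WSol.le {m : ℕ} {G H : ℝ → ℝ} {S : ℝ} {w u : ℝ → ℝ} (hw : WSol m G S w) (hu : WSol m H S u)
    (hG : ∀ x, 0 ≤ G x) (hH : ∀ x, 0 ≤ H x) (hanti : AntitoneOn H (Ici 0)) (hGH : ∀ x, G x ≤ H x) :
    ∀ r ∈ Ico 0 S, w r ≤ u r := by
  apply cmp_aux m S w u (fun r => G (w r)) (fun r => H (u r)) hw.2.1 hu.2.1 (by rw [hw.1, hu.1])
    hw.2.2 hu.2.2
  intro r hr hlt
  have hr' : r ∈ Ico 0 S := ⟨hr.1.le, hr.2⟩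
  exact (hGH _).trans (hanti (hu.nonneg hH r hr') (hw.nonneg hG r hr') hlt.le)

lemma WSol.le_add {m : ℕ} {G H : ℝ → ℝ} {S K : ℝ} {w u : ℝ → ℝ} (hw : WSol m G S w)
    (hu : WSol m H S u) (hK : 0 ≤ K)
    (hanti : Antitone H) (hGH : ∀ x, G x ≤ H x + K) :
    ∀ r ∈ Ico 0 S, w r - K / (m + 1) * r ≤ u r := by
  apply cmp_aux m S (fun r => w r - K / (m + 1) * r) u (fun r => G (w r) - K) (fun r => H (u r))
    (hw.2.1.sub (by fun_prop)) hu.2.1 (by simp [hw.1, hu.1]) _ hu.2.2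
  · intro r hr hlt
    have h1 : 0 ≤ K / (m + 1) * r := by have := hr.1; positivity
    have := hanti (show u r ≤ w r by linarith)
    linarith [hGH (w r)]
  · intro r hr
    refine ((hw.2.2 r hr).sub (lin_deriv m K r hr.1.ne')).congr_deriv ?_
    ring

lemma WSol.monotone {m : ℕ} {G : ℝ → ℝ} {S : ℝ} {w : ℝ → ℝ} (hw : WSol m G S w)
    (hG : ∀ x, 0 ≤ G x) (hanti : Antitone G) :
    ∀ r ∈ Ico 0 S, ∀ s ∈ Icc 0 r, w s ≤ w r := by
  intro r hr s hs
  rcases eq_or_lt_of_le hr.1 with h0 | h0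
  · have : s = r := by linarith [hs.1, hs.2]
    rw [this]
  set l := s / r with hl
  have hl0 : 0 ≤ l := div_nonneg hs.1 hr.1
  have hl1 : l ≤ 1 := (div_le_one h0).2 hs.2
  have hsl : s = l * r := by rw [hl]; field_simp
  rcases eq_or_lt_of_le hl0 with hl0' | hl0'
  · rw [hsl, ← hl0', zero_mul, hw.1]
    exact hw.nonneg hG r hr
  have key : ∀ r ∈ Ico 0 S, w (l * r) ≤ w r := by
    apply cmp_aux m S (fun r => w (l * r)) w (fun r => l * G (w (l * r))) (fun r => G (w r)) _
      hw.2.1 (by simp) _ hw.2.2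
    · intro x hx hlt
      have h1 := hanti hlt.le
      have h2 := hG (w (l * x))
      nlinarith
    · refine hw.2.1.comp (by fun_prop) ?_
      intro x hx
      exact ⟨mul_nonneg hl0 hx.1, by nlinarith [hx.1, hx.2]⟩
    · intro x hx
      have hm : l * x ∈ Ioo 0 S := ⟨mul_pos hl0' hx.1, by nlinarith [hx.1, hx.2]⟩
      have hd : HasDerivAt (fun x : ℝ => l * x) l x := by simpa using (hasDerivAt_id x).const_mul l
      refine ((hw.2.2 _ hm).comp x hd).congr_deriv ?_
      have := hx.1.ne'
      field_simp
  rw [hsl]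
  exact key r hr

lemma WSol.strict {m : ℕ} {G H : ℝ → ℝ} {S : ℝ} {w u : ℝ → ℝ} (hw : WSol m G S w) (hu : WSol m H S u)
    (hG : ∀ x, 0 ≤ G x) (hH : ∀ x, 0 ≤ H x) (hanti : AntitoneOn H (Ici 0)) (hGH : ∀ x, G x ≤ H x)
    (hS : 1 < S) (heq : w 1 = u 1) : H (u 1) ≤ G (w 1) := by
  by_contra! hlt
  have hle := hw.le hu hG hH hanti hGH
  have h1 : (1:ℝ) ∈ Ioo 0 S := ⟨one_pos, hS⟩
  have hd := (hu.2.2 1 h1).sub (hw.2.2 1 h1)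
  have hmin : IsLocalMin (u - w) 1 := by
    filter_upwards [Ioo_mem_nhds h1.1 h1.2] with x hx
    simp only [Pi.sub_apply]
    linarith [hle x ⟨hx.1.le, hx.2⟩]
  have := hmin.hasDerivAt_eq_zero hd
  rw [heq] at this hlt
  linarith

lemma oddPow_eq {p β c s : ℝ} (hβ : 0 < β) (hc : 0 ≤ c) (hs : 0 ≤ s) :
    oddPow (c * s - -β) p = (c * s + β) ^ p := by
  have : 0 ≤ c * s := by positivity
  rw [oddPow, if_pos (by linarith), sub_neg_eq_add]

lemma profile_to_W {m : ℕ} {α β c S : ℝ} {φ φ' φ'' : ℝ → ℝ} (hβ : 0 < β) (hc : 0 ≤ c)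
    (h : IsProfileSolOn (m + 1) α (-β) c (Ico 0 S) φ φ' φ'') :
    WSol m (GG (1 / α) β c) S (fun r => φ' r / Real.sqrt (1 + φ' r ^ 2)) := by
  obtain ⟨-, h0, -, hd, he⟩ := h
  have hq : ∀ x : ℝ, 0 < Real.sqrt (1 + x ^ 2) := fun x => Real.sqrt_pos.2 (by positivity)
  have hder : ∀ x : ℝ, HasDerivAt (fun x : ℝ => x / Real.sqrt (1 + x ^ 2))
      (1 / Real.sqrt (1 + x ^ 2) ^ 3) x := by
    intro x
    have h1 : HasDerivAt (fun x : ℝ => 1 + x ^ 2) (2 * x) x := by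
      simpa using (hasDerivAt_pow 2 x).const_add 1
    have h2 := (hasDerivAt_id x).div (h1.sqrt (by positivity)) (hq x).ne'
    refine h2.congr_deriv ?_
    have h3 := Real.sq_sqrt (show (0:ℝ) ≤ 1 + x ^ 2 by positivity)
    have := (hq x).ne'
    simp only [id]
    field_simp
    linarith
  refine ⟨by simp [h0], ?_, ?_⟩
  · intro r hr
    exact ((hder _).comp_hasDerivWithinAt r (hd r hr)).continuousWithinAt
  · intro r hr
    have hr' : r ∈ Ico 0 S := ⟨hr.1.le, hr.2⟩
    have hd' := (hd r hr').hasDerivAt (Ico_mem_nhds hr.1 hr.2)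
    refine ((hder _).comp r hd').congr_deriv ?_
    have e := he r hr' hr.1.ne'
    have hqr := hq (φ' r)
    have hq2 := Real.sq_sqrt (show (0:ℝ) ≤ 1 + φ' r ^ 2 by positivity)
    have hs : Real.sqrt (1 - (φ' r / Real.sqrt (1 + φ' r ^ 2)) ^ 2) = 1 / Real.sqrt (1 + φ' r ^ 2) := by
      rw [Real.sqrt_eq_iff_mul_self_eq_of_pos (by positivity)]
      field_simp
      linarith
    rw [div_eq_mul_one_div c, oddPow_eq hβ hc (by positivity), ← hs] at e
    unfold GG
    set X := (c * Real.sqrt (1 - (φ' r / Real.sqrt (1 + φ' r ^ 2)) ^ 2) + β) ^ (1 / α)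
    set q := Real.sqrt (1 + φ' r ^ 2)
    have hr0 := hr.1.ne'
    push_cast at e
    have e1 : X = (φ'' r / q ^ 2 + (m + 1 - 1) / r * φ' r) / q := by
      rw [eq_div_iff hqr.ne', hq2, ← e]
    rw [e1]
    field_simp
    ring

lemma W_to_profile {m : ℕ} {α β c S κ : ℝ} {w : ℝ → ℝ} (hp : 0 < 1 / α) (hβ : 0 < β) (hc : 0 ≤ c)
    (hκ0 : 0 ≤ κ) (hκ1 : κ < 1) (hcont : Continuous w) (h0 : w 0 = 0) (d0 : ℝ)
    (hd0 : HasDerivAt w d0 0)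
    (hw : WSol m (fun x => GG (1 / α) β c (clampK κ x)) S w)
    (hle : ∀ r ∈ Ico 0 S, w r ≤ κ) :
    ∃ φ φ' φ'' : ℝ → ℝ, IsProfileSolOn (m + 1) α (-β) c (Ico 0 S) φ φ' φ'' ∧
      ∀ r ∈ Ico 0 S, φ' r = w r / Real.sqrt (1 - w r ^ 2) := by
  have hG : ∀ x, 0 ≤ GG (1 / α) β c (clampK κ x) := fun x =>
    (Real.rpow_nonneg hβ.le _).trans (GG_lower hp hβ hc _)
  have hnn := hw.nonneg hG
  set f : ℝ → ℝ := fun x => x / Real.sqrt (1 - x ^ 2) with hf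
  have hq : ∀ x ∈ Icc 0 κ, 0 < 1 - x ^ 2 := fun x hx => by nlinarith [hx.1, hx.2]
  have hder : ∀ x ∈ Icc 0 κ, HasDerivAt f (1 / Real.sqrt (1 - x ^ 2) ^ 3) x := by
    intro x hx
    have h1 : HasDerivAt (fun x : ℝ => 1 - x ^ 2) (-(2 * x)) x := by
      simpa using (hasDerivAt_pow 2 x).const_sub 1
    have hqp := Real.sqrt_pos.2 (hq x hx)
    have h2 := (hasDerivAt_id x).div (h1.sqrt (hq x hx).ne') hqp.ne'
    refine h2.congr_deriv ?_
    have h3 := Real.sq_sqrt (hq x hx).le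
    simp only [id]
    field_simp
    linarith
  have hvc : Continuous (fun r => f (clampK κ (w r))) := by
    have h1 : ContinuousOn f (Icc 0 κ) := fun x hx => (hder x hx).continuousAt.continuousWithinAt
    exact h1.comp_continuous ((clampK_lip κ).continuous.comp hcont) (fun r => clampK_mem hκ0 _)
  have hcl : ∀ r ∈ Ico 0 S, clampK κ (w r) = w r := fun r hr => clampK_eq (hnn r hr) (hle r hr)
  set D : ℝ → ℝ := fun r => if r = 0 then d0 else GG (1 / α) β c (clampK κ (w r)) - m * w r / r
    with hD
  refine ⟨fun r => ∫ s in (0:ℝ)..r, f (clampK κ (w s)), fun r => f (clampK κ (w r)),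
    fun r => 1 / Real.sqrt (1 - w r ^ 2) ^ 3 * D r, ⟨by simp, ?_, ?_, ?_, ?_⟩, ?_⟩
  · simp [h0, clampK_eq le_rfl hκ0, hf]
  · intro r _
    exact (intervalIntegral.integral_hasDerivAt_right (hvc.intervalIntegrable _ _)
        (hvc.stronglyMeasurableAtFilter _ _) hvc.continuousAt).hasDerivWithinAt
  · intro r hr
    have h1 : HasDerivAt w (D r) r := by
      by_cases hr0 : r = 0
      · simp only [hD, hr0, if_true]
        exact hd0
      · simp only [hD, hr0, if_false]
        exact hw.2.2 r ⟨lt_of_le_of_ne hr.1 (Ne.symm hr0), hr.2⟩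
    have h2 := (hder (w r) ⟨hnn r hr, hle r hr⟩).comp r h1
    refine h2.hasDerivWithinAt.congr ?_ ?_
    · intro s hs
      simp only [Function.comp, hcl s hs]
    · simp only [Function.comp, hcl r hr]
  · intro r hr hr0
    have hm : w r ∈ Icc 0 κ := ⟨hnn r hr, hle r hr⟩
    have hqp := Real.sqrt_pos.2 (hq _ hm)
    have hq2 := Real.sq_sqrt (hq _ hm).le
    simp only [hD, hr0, if_false, hcl r hr, hf]
    have hs2 : 1 + (w r / Real.sqrt (1 - w r ^ 2)) ^ 2 = (1 / Real.sqrt (1 - w r ^ 2)) ^ 2 := by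
      field_simp
      linarith
    rw [hs2, Real.sqrt_sq (by positivity), div_div_eq_mul_div, div_one, oddPow_eq hβ hc hqp.le]
    unfold GG
    set X := (c * Real.sqrt (1 - w r ^ 2) + β) ^ (1 / α)
    set q := Real.sqrt (1 - w r ^ 2)
    push_cast
    field_simp
    ring
  · intro r hr
    simp only [hcl r hr, hf]

lemma v_of_w (v : ℝ) : v = (v / Real.sqrt (1 + v ^ 2)) / Real.sqrt (1 - (v / Real.sqrt (1 + v ^ 2)) ^ 2) := by
  have hqr : 0 < Real.sqrt (1 + v ^ 2) := Real.sqrt_pos.2 (by positivity)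
  have hq2 := Real.sq_sqrt (show (0:ℝ) ≤ 1 + v ^ 2 by positivity)
  have hs : Real.sqrt (1 - (v / Real.sqrt (1 + v ^ 2)) ^ 2) = 1 / Real.sqrt (1 + v ^ 2) := by
    rw [Real.sqrt_eq_iff_mul_self_eq_of_pos (by positivity)]
    field_simp
    linarith
  rw [hs]
  field_simp

lemma IsProfileSolOn.mono {N : ℕ} {α b c S S' : ℝ} {φ φ' φ'' : ℝ → ℝ}
    (h : IsProfileSolOn N α b c (Ico 0 S) φ φ' φ'') (hS : S' ≤ S) :
    IsProfileSolOn N α b c (Ico 0 S') φ φ' φ'' := by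
  have hsub : Ico 0 S' ⊆ Ico 0 S := Ico_subset_Ico_right hS
  exact ⟨h.1, h.2.1, fun r hr => (h.2.2.1 r (hsub hr)).mono hsub,
    fun r hr => (h.2.2.2.1 r (hsub hr)).mono hsub, fun r hr => h.2.2.2.2 r (hsub hr)⟩

lemma profile_unique {m : ℕ} {α β c S : ℝ} {φ φ' φ'' ψ ψ' ψ'' : ℝ → ℝ} (hp : 0 < 1 / α) (hβ : 0 < β)
    (hc : 0 ≤ c)
    (h1 : IsProfileSolOn (m + 1) α (-β) c (Ico 0 S) φ φ' φ'')
    (h2 : IsProfileSolOn (m + 1) α (-β) c (Ico 0 S) ψ ψ' ψ'') :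
    EqOn φ ψ (Ico 0 S) ∧ EqOn φ' ψ' (Ico 0 S) := by
  have hG : ∀ x, 0 ≤ GG (1 / α) β c x := fun x =>
    (Real.rpow_nonneg hβ.le _).trans (GG_lower hp hβ hc _)
  have w1 := profile_to_W hβ hc h1
  have w2 := profile_to_W hβ hc h2
  have h' : EqOn φ' ψ' (Ico 0 S) := by
    intro r hr
    have e := le_antisymm (w1.le w2 hG hG (GG_anti hp hβ hc) (fun _ => le_rfl) r hr)
      (w2.le w1 hG hG (GG_anti hp hβ hc) (fun _ => le_rfl) r hr)
    rw [v_of_w (φ' r), e, ← v_of_w]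
  refine ⟨?_, h'⟩
  intro r hr
  have hsub : Icc 0 r ⊆ Ico 0 S := fun x hx => ⟨hx.1, hx.2.trans_lt hr.2⟩
  have hd : ∀ x ∈ Ico 0 S, HasDerivWithinAt (fun x => φ x - ψ x) 0 (Ico 0 S) x := by
    intro x hx
    refine ((h1.2.2.1 x hx).sub (h2.2.2.1 x hx)).congr_deriv ?_
    rw [h' hx, sub_self]
  have := constant_of_has_deriv_right_zero (f := fun x => φ x - ψ x) (a := 0) (b := r)
    (fun x hx => (hd x (hsub hx)).continuousWithinAt.mono hsub)
    (fun x hx => by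
      have hx' : x ∈ Ico 0 S := ⟨hx.1, hx.2.trans hr.2⟩
      refine ((hd x hx').mono (Ico_subset_Ico_left hx.1)).mono_of_mem_nhdsWithin ?_
      exact Ico_mem_nhdsGE hx'.2) r ⟨hr.1, le_rfl⟩
  simp only [h1.1, h2.1] at this
  linarith

lemma profile_bound {m : ℕ} {α β c S : ℝ} {φ φ' φ'' : ℝ → ℝ} (hp : 0 < 1 / α) (hβ : 0 < β)
    (hc : 0 ≤ c) (h1 : IsProfileSolOn (m + 1) α (-β) c (Ico 0 S) φ φ' φ'') :
    S ≤ (m + 1) / β ^ (1 / α) := by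
  have w1 := profile_to_W hβ hc h1
  have hb : 0 < β ^ (1 / α) := Real.rpow_pos_of_pos hβ _
  apply le_of_forall_lt_imp_le_of_dense
  intro r hr
  rcases le_or_gt r 0 with hr0 | hr0
  · exact hr0.trans (by positivity)
  have h2 := w1.lower (GG_lower hp hβ hc) r ⟨hr0.le, hr⟩
  have h3 : φ' r / Real.sqrt (1 + φ' r ^ 2) ≤ 1 := by
    rw [div_le_one (Real.sqrt_pos.2 (by positivity))]
    exact Real.le_sqrt_of_sq_le (by linarith)
  have h4 := h2.trans h3
  have hm : (0:ℝ) < m + 1 := by positivity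
  rw [le_div_iff₀ hb]
  rw [div_mul_eq_mul_div, div_le_one hm] at h4
  linarith

lemma exists_max {m : ℕ} {α β c S0 : ℝ} {φ0 φ0' φ0'' : ℝ → ℝ} (hp : 0 < 1 / α) (hβ : 0 < β)
    (hc : 0 ≤ c) (hS0 : 0 < S0)
    (h0 : IsProfileSolOn (m + 1) α (-β) c (Ico 0 S0) φ0 φ0' φ0'') :
    ∃ R φ φ' φ'', IsMaxProfileSol (m + 1) α (-β) c R φ φ' φ'' ∧ S0 ≤ R ∧
      EqOn φ' φ0' (Ico 0 S0) := by
  set A : Set ℝ := {S | 0 < S ∧ ∃ φ φ' φ'', IsProfileSolOn (m + 1) α (-β) c (Ico 0 S) φ φ' φ''}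
  have hA0 : S0 ∈ A := ⟨hS0, _, _, _, h0⟩
  have hbdd : BddAbove A := ⟨(m + 1) / β ^ (1 / α), by
    rintro S ⟨hS, φ, φ', φ'', h⟩
    exact profile_bound hp hβ hc h⟩
  set R := sSup A
  have hS0R : S0 ≤ R := le_csSup hbdd hA0
  have hex : ∀ r, ∃ (S : ℝ) (φ φ' φ'' : ℝ → ℝ), r < R →
      r < S ∧ S ≤ R ∧ IsProfileSolOn (m + 1) α (-β) c (Ico 0 S) φ φ' φ'' := by
    intro r
    by_cases hr : r < R
    · obtain ⟨S, hSA, hrS⟩ := exists_lt_of_lt_csSup ⟨S0, hA0⟩ hr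
      obtain ⟨hS, φ, φ', φ'', h⟩ := hSA
      exact ⟨S, φ, φ', φ'', fun _ => ⟨hrS, le_csSup hbdd ⟨hS, φ, φ', φ'', h⟩, h⟩⟩
    · exact ⟨0, 0, 0, 0, fun h => absurd h hr⟩
  choose S φ φ' φ'' hS using hex
  have key : ∀ S1 ψ ψ' ψ'', S1 ≤ R → IsProfileSolOn (m + 1) α (-β) c (Ico 0 S1) ψ ψ' ψ'' →
      EqOn (fun r => φ r r) ψ (Ico 0 S1) ∧ EqOn (fun r => φ' r r) ψ' (Ico 0 S1) := by
    intro S1 ψ ψ' ψ'' hS1 hψ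
    have : ∀ r ∈ Ico 0 S1, φ r r = ψ r ∧ φ' r r = ψ' r := by
      intro r hr
      obtain ⟨a1, a2, a3⟩ := hS r (hr.2.trans_le hS1)
      have hu := profile_unique hp hβ hc (a3.mono (min_le_left (S r) S1)) (hψ.mono (min_le_right (S r) S1))
      have hm : r ∈ Ico 0 (min (S r) S1) := ⟨hr.1, lt_min a1 hr.2⟩
      exact ⟨hu.1 hm, hu.2 hm⟩
    exact ⟨fun r hr => (this r hr).1, fun r hr => (this r hr).2⟩
  have hR : 0 < R := hS0.trans_le hS0R
  refine ⟨R, fun r => φ r r, fun r => φ' r r, fun r => φ'' r r, ⟨hR, ⟨?_, ?_, ?_, ?_, ?_⟩, ?_⟩, hS0R,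
    (key S0 _ _ _ hS0R h0).2⟩
  · exact (hS 0 hR).2.2.1
  · exact (hS 0 hR).2.2.2.1
  · intro r hr
    obtain ⟨a1, a2, a3⟩ := hS r hr.2
    have hk := key _ _ _ _ a2 a3
    have hm : r ∈ Ico 0 (S r) := ⟨hr.1, a1⟩
    have := (a3.2.2.1 r hm).congr hk.1 (hk.1 hm)
    refine this.mono_of_mem_nhdsWithin ?_
    filter_upwards [self_mem_nhdsWithin, mem_nhdsWithin_of_mem_nhds (Iio_mem_nhds a1)] with x hx hx2
    exact ⟨hx.1, hx2⟩
  · intro r hr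
    obtain ⟨a1, a2, a3⟩ := hS r hr.2
    have hk := key _ _ _ _ a2 a3
    have hm : r ∈ Ico 0 (S r) := ⟨hr.1, a1⟩
    have := (a3.2.2.2.1 r hm).congr hk.2 (hk.2 hm)
    refine this.mono_of_mem_nhdsWithin ?_
    filter_upwards [self_mem_nhdsWithin, mem_nhdsWithin_of_mem_nhds (Iio_mem_nhds a1)] with x hx hx2
    exact ⟨hx.1, hx2⟩
  · intro r hr hr0
    obtain ⟨a1, a2, a3⟩ := hS r hr.2
    exact a3.2.2.2.2 r ⟨hr.1, a1⟩ hr0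
  · intro S1 ψ ψ' ψ'' hS1 hψ
    have hle : S1 ≤ R := le_csSup hbdd ⟨hS1, ψ, ψ', ψ'', hψ⟩
    exact ⟨hle, fun r hr => ((key S1 _ _ _ hle hψ).1 hr).symm⟩

lemma speed_unique {m : ℕ} {α β c d k R1 R2 : ℝ} {φ φ' φ'' ψ ψ' ψ'' : ℝ → ℝ} (hp : 0 < 1 / α)
    (hβ : 0 < β) (hc : 0 ≤ c) (hcd : c < d)
    (h1 : IsProfileSolOn (m + 1) α (-β) c (Ico 0 R1) φ φ' φ'')
    (h2 : IsProfileSolOn (m + 1) α (-β) d (Ico 0 R2) ψ ψ' ψ'')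
    (hR1 : 1 < R1) (hR2 : 1 < R2) (hk1 : φ' 1 = k) (hk2 : ψ' 1 = k) : False := by
  have hd : 0 ≤ d := hc.trans hcd.le
  have hG : ∀ c, 0 ≤ c → ∀ x, 0 ≤ GG (1 / α) β c x := fun c hc x =>
    (Real.rpow_nonneg hβ.le _).trans (GG_lower hp hβ hc _)
  have w1 := (profile_to_W hβ hc h1).mono (min_le_left R1 R2)
  have w2 := (profile_to_W hβ hd h2).mono (min_le_right R1 R2)
  have := w1.strict w2 (hG c hc) (hG d hd) (GG_anti hp hβ hd) (GG_mono_c hp hβ hc hcd.le)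
    (lt_min hR1 hR2) (by simp [hk1, hk2])
  simp only [hk1, hk2] at this
  refine absurd this (not_le.2 ?_)
  have hq2 := Real.sq_sqrt (show (0:ℝ) ≤ 1 + k ^ 2 by positivity)
  have hs : 0 < Real.sqrt (1 - (k / Real.sqrt (1 + k ^ 2)) ^ 2) := by
    apply Real.sqrt_pos.2
    rw [div_pow, hq2, sub_pos, div_lt_one (by positivity)]
    linarith
  apply Real.rpow_lt_rpow (by positivity) _ hp
  gcongr

lemma speed_exists (m : ℕ) {α β κ0 : ℝ} (hα : 0 < α) (hβ : 0 < β) (hκ0 : 0 < κ0) (hκ1 : κ0 < 1)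
    (hlt : β ^ (1 / α) / (m + 1) < κ0) :
    ∃ c, 0 < c ∧ ∃ S φ φ' φ'', 1 < S ∧ IsProfileSolOn (m + 1) α (-β) c (Ico 0 S) φ φ' φ'' ∧
      φ' 1 = κ0 / Real.sqrt (1 - κ0 ^ 2) := by
  have hp : 0 < 1 / α := by positivity
  obtain ⟨κ, hκa, hκb⟩ := exists_between hκ1
  have hκn : 0 ≤ κ := by linarith
  set g : ℝ → ℝ → ℝ := fun c x => GG (1 / α) β c (clampK κ x) with hg
  have hgl : ∀ c, 0 ≤ c → ∀ x, 0 ≤ g c x := fun c hc x =>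
    (Real.rpow_nonneg hβ.le _).trans (GG_lower hp hβ hc _)
  have hga : ∀ c, 0 ≤ c → Antitone (g c) := fun c hc => GGc_anti hp hβ hc
  have hex : ∀ c, ∃ w : ℝ → ℝ, 0 ≤ c → Continuous w ∧ w 0 = 0 ∧ HasDerivAt w (g c 0 / (m + 1)) 0 ∧
      ∀ r ∈ Ioo (0:ℝ) 2, HasDerivAt w (g c (w r) - m * w r / r) r := by
    intro c
    by_cases hc : 0 ≤ c
    · obtain ⟨L, hL⟩ := GGc_lip (p := 1 / α) hβ hc hκn hκb
      obtain ⟨w, hw⟩ := exists_aux m L (g c) hL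
      exact ⟨w, fun _ => hw⟩
    · exact ⟨0, fun h => absurd h hc⟩
  choose W hW using hex
  have hWS : ∀ c, 0 ≤ c → WSol m (g c) 2 (W c) := fun c hc =>
    ⟨(hW c hc).2.1, (hW c hc).1.continuousOn, (hW c hc).2.2.2⟩
  have h12 : (1:ℝ) ∈ Ico (0:ℝ) 2 := ⟨zero_le_one, one_lt_two⟩
  have hm1 : (0:ℝ) < m + 1 := by positivity
  -- value at speed zero
  have hzero : W 0 1 < κ0 := by
    have hc0 : WSol m (fun _ => β ^ (1 / α)) 2 (W 0) := by
      have := hWS 0 le_rfl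
      have e : g 0 = fun _ => β ^ (1 / α) := by
        ext x
        simp [hg, GG]
      rwa [e] at this
    have hlin : WSol m (fun _ => β ^ (1 / α)) 2 (fun r : ℝ => β ^ (1 / α) / (m + 1) * r) :=
      ⟨by simp, by fun_prop, fun r hr => lin_deriv m _ r hr.1.ne'⟩
    have hb : 0 ≤ β ^ (1 / α) := Real.rpow_nonneg hβ.le _
    have := hc0.le hlin (fun _ => hb) (fun _ => hb) (fun _ _ _ _ _ => le_rfl) (fun _ => le_rfl) 1 h12
    simp only [mul_one] at this
    linarith
  -- large speed
  set s := Real.sqrt (1 - κ ^ 2) with hs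
  have hspos : 0 < s := Real.sqrt_pos.2 (by nlinarith)
  set C : ℝ := (m + 1 : ℝ) ^ α / s with hC
  have hC0 : 0 ≤ C := by positivity
  have hlarge : κ0 ≤ W C 1 := by
    have hlow : ∀ x, (m + 1 : ℝ) ≤ g C x := by
      intro x
      have hm := clampK_mem hκn x
      have h1 : GG (1 / α) β C κ ≤ g C x := GG_anti hp hβ hC0 hm.1 hκn hm.2
      refine le_trans ?_ h1
      have h2 : (m + 1 : ℝ) = ((m + 1 : ℝ) ^ α) ^ (1 / α) := by
        rw [← Real.rpow_mul hm1.le, mul_one_div_cancel hα.ne', Real.rpow_one]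
      rw [h2]
      apply Real.rpow_le_rpow (by positivity) _ hp.le
      rw [← hs, hC, div_mul_cancel₀ _ hspos.ne']
      linarith
    have := (hWS C hC0).lower hlow 1 h12
    rw [div_self hm1.ne', one_mul] at this
    linarith
  -- continuity in the speed
  have hcont : ContinuousOn (fun c => W c 1) (Icc 0 C) := by
    have hjc : ContinuousOn (fun z : ℝ × ℝ => GG (1 / α) β z.1 z.2) (Icc 0 C ×ˢ Icc 0 κ) := by
      apply Continuous.continuousOn
      unfold GG
      refine Continuous.rpow_const (by fun_prop) fun _ => Or.inr hp.le
    have huc := (isCompact_Icc.prod isCompact_Icc).uniformContinuousOn_of_continuous hjc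
    rw [Metric.uniformContinuousOn_iff] at huc
    rw [Metric.continuousOn_iff]
    intro c hc ε hε
    obtain ⟨δ, hδ, hu⟩ := huc (ε / 2) (by positivity)
    refine ⟨δ, hδ, fun d hd hdc => ?_⟩
    have hgg : ∀ x, |g d x - g c x| < ε / 2 := by
      intro x
      have hm := clampK_mem hκn x
      exact hu (d, clampK κ x) ⟨hd, hm⟩ (c, clampK κ x) ⟨hc, hm⟩ (by
        rw [Prod.dist_eq]
        simpa using hdc)
    have e1 := (hWS d hd.1).le_add (hWS c hc.1) (K := ε / 2) (by positivity) (hga c hc.1)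
      (fun x => by linarith [(abs_lt.1 (hgg x)).2]) 1 h12
    have e2 := (hWS c hc.1).le_add (hWS d hd.1) (K := ε / 2) (by positivity) (hga d hd.1)
      (fun x => by linarith [(abs_lt.1 (hgg x)).1]) 1 h12
    have e3 : ε / 2 / (m + 1) ≤ ε / 2 := div_le_self (by positivity) (by simp)
    rw [Real.dist_eq, abs_lt]
    constructor <;> linarith
  obtain ⟨c, hcm, hc1⟩ := intermediate_value_Icc hC0 hcont ⟨hzero.le, hlarge⟩
  simp only at hc1
  have hcpos : 0 < c := by
    rcases eq_or_lt_of_le hcm.1 with h | h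
    · rw [← h] at hc1; linarith
    · exact h
  have hWc := (hW c hcm.1).1
  -- a bit beyond radius one
  have hev : ∀ᶠ r in 𝓝[>] (1:ℝ), W c r < κ ∧ r < 2 := by
    have h1 : ∀ᶠ r in 𝓝 (1:ℝ), W c r < κ :=
      hWc.continuousAt.eventually_lt continuousAt_const (by rw [hc1]; exact hκa)
    exact ((h1.and (Iio_mem_nhds one_lt_two)).filter_mono nhdsWithin_le_nhds)
  obtain ⟨S, ⟨hSκ, hS2⟩, hS1⟩ := (hev.and self_mem_nhdsWithin).exists
  have hS1 : 1 < S := hS1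
  have hmon := (hWS c hcm.1).monotone (hgl c hcm.1) (hga c hcm.1)
  obtain ⟨φ, φ', φ'', hsol, hv⟩ := W_to_profile (S := S) hp hβ hcm.1 hκn hκb hWc (hW c hcm.1).2.1 _
    (hW c hcm.1).2.2.1 ((hWS c hcm.1).mono hS2.le) (fun r hr =>
      (hmon S ⟨by linarith, hS2⟩ r ⟨hr.1, hr.2.le⟩).trans hSκ.le)
  refine ⟨c, hcpos, S, φ, φ', φ'', hS1, hsol, ?_⟩
  rw [hv 1 ⟨zero_le_one, hS1⟩, hc1]

/-- for `b < 0 < k` with `(−b)^{1/α}√(1+k²) < kN`, there is a unique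
speed `c̃ > 0` whose translating profile is defined on an interval containing `[0, 1]`
and satisfies `Φ'(1; c̃, b) = k`. -/
theorem stmt12 (N : ℕ) (hN : 1 < N) (α b k : ℝ) (hα : 0 < α) (hb : b < 0) (hk : 0 < k)
    (hbk : (-b) ^ (1 / α) * Real.sqrt (1 + k ^ 2) < k * (N : ℝ)) :
    ∃! ct : ℝ, 0 < ct ∧
      ∃ (R : ℝ) (φ φ' φ'' : ℝ → ℝ),
        IsMaxProfileSol N α b ct R φ φ' φ'' ∧ 1 < R ∧ φ' 1 = k := by
  obtain ⟨m, rfl⟩ : ∃ m, N = m + 1 := ⟨N - 1, by omega⟩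
  obtain ⟨β, rfl⟩ : ∃ β, b = -β := ⟨-b, by ring⟩
  have hβ : 0 < β := by linarith
  have hp : 0 < 1 / α := by positivity
  rw [neg_neg] at hbk
  have hq : 0 < Real.sqrt (1 + k ^ 2) := Real.sqrt_pos.2 (by positivity)
  have hlt : β ^ (1 / α) / ((m : ℝ) + 1) < k / Real.sqrt (1 + k ^ 2) := by
    rw [div_lt_div_iff₀ (by positivity) hq]
    push_cast at hbk
    exact hbk
  have hκ1 : k / Real.sqrt (1 + k ^ 2) < 1 := by
    rw [div_lt_one hq]
    exact Real.lt_sqrt_of_sq_lt (by linarith)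
  obtain ⟨c, hc, S, φ0, φ0', φ0'', hS, hsol, hk1⟩ :=
    speed_exists m hα hβ (by positivity) hκ1 hlt
  rw [← v_of_w] at hk1
  obtain ⟨R, φ, φ', φ'', hmax, hSR, heq⟩ := exists_max hp hβ hc.le (by linarith) hsol
  refine ⟨c, ⟨hc, R, φ, φ', φ'', hmax, by linarith, ?_⟩, ?_⟩
  · rw [heq ⟨zero_le_one, hS⟩, hk1]
  · rintro d ⟨hd, R2, ψ, ψ', ψ'', hmax2, hR2, hk2⟩
    rcases lt_trichotomy d c with h | h | h
    · exact (speed_unique hp hβ hd.le h hmax2.2.1 hsol hR2 hS hk2 hk1).elim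
    · exact h
    · exact (speed_unique hp hβ hc.le h hsol hmax2.2.1 hS hR2 hk1 hk2).elim
end
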